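/- There exist universal constants C > 0 and c ≥ 1 such that for any projection game G, ‖G‖*² ≤ val₊*(G) ≤ 1 − C·(1 − ‖G‖*²)^c. -/

import Mathlib

noncomputable section
open scoped Kronecker ComplexOrder
open Matrix

/-- `d × d` complex matrices. -/
abbrev Mat (d : ℕ) := Matrix (Fin d) (Fin d) ℂ

/-- Entrywise complex conjugation of a matrix. -/
def mconj {m n : Type*} (M : Matrix m n ℂ) : Matrix m n ℂ := M.map (starRingEnd ℂ)

/-- Operator (spectral) norm of a square complex matrix. -/
noncomputable def opNorm {n : Type*} [Fintype n] [DecidableEq n] (M : Matrix n n ℂ) : ℝ :=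
  ‖Matrix.toEuclideanCLM (𝕜 := ℂ) M‖

/-- `⟨ψ| M |ψ⟩`. -/
def braket {ι : Type*} [Fintype ι] (ψ : ι → ℂ) (M : Matrix ι ι ℂ) : ℂ :=
  star ψ ⬝ᵥ M.mulVec ψ

/-- Squared Euclidean norm of a complex vector. -/
def enormSq {ι : Type*} [Fintype ι] (ψ : ι → ℂ) : ℝ := ∑ i, Complex.normSq (ψ i)

/-- A family of psd matrices summing to the identity. -/
def IsPOVM {d : ℕ} {α : Type*} [Fintype α] (M : α → Mat d) : Prop :=
  (∀ a, (M a).PosSemidef) ∧ (∑ a, M a) = 1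

/-- A two-player one-round projection game. -/
structure ProjGame where
  U : Type
  V : Type
  A : Type
  B : Type
  [fU : Fintype U]
  [fV : Fintype V]
  [fA : Fintype A]
  [fB : Fintype B]
  [dA : DecidableEq A]
  μ : U → V → ℝ
  μ_nonneg : ∀ u v, 0 ≤ μ u v
  μ_sum : ∑ u, ∑ v, μ u v = 1
  proj : U → V → B → Option A

attribute [instance] ProjGame.fU ProjGame.fV ProjGame.fA ProjGame.fB ProjGame.dA

namespace ProjGame

variable (G : ProjGame)

/-- Marginal distribution on first-player questions. -/
def μL (u : G.U) : ℝ := ∑ v, G.μ u v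

/-- Marginal distribution on second-player questions. -/
def μR (v : G.V) : ℝ := ∑ u, G.μ u v

/-- Conditional distribution `μ(v|u)`. -/
def μc (u : G.U) (v : G.V) : ℝ := G.μ u v / G.μL u

/-- A `d`-dimensional quantum strategy for the first player. -/
def IsStrategyA {d : ℕ} (A : G.U → G.A → Mat d) : Prop := ∀ u, IsPOVM (A u)

/-- A `d`-dimensional quantum strategy for the second player. -/
def IsStrategyB {d : ℕ} (B : G.V → G.B → Mat d) : Prop := ∀ v, IsPOVM (B v)

/-- Success probability of a pair of quantum strategies with shared state `ψ`. -/
def pay {d : ℕ} (A : G.U → G.A → Mat d) (B : G.V → G.B → Mat d)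
    (ψ : Fin d × Fin d → ℂ) : ℝ :=
  ∑ u, ∑ v, G.μ u v * ∑ a, ∑ b,
    if G.proj u v b = some a then (braket ψ (mconj (A u a) ⊗ₖ B v b)).re else 0

/-- The entangled value `val*(G)`. -/
noncomputable def entVal : ℝ :=
  sSup { x | ∃ (d : ℕ) (A : G.U → G.A → Mat d) (B : G.V → G.B → Mat d)
    (ψ : Fin d × Fin d → ℂ),
    G.IsStrategyA A ∧ G.IsStrategyB B ∧ enormSq ψ = 1 ∧ x = G.pay A B ψ }

/-- The operator `B_u^a = Σ_v μ(v|u) Σ_{b → a} B_v^b`. -/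
def Bop {d : ℕ} (B : G.V → G.B → Mat d) (u : G.U) (a : G.A) : Mat d :=
  ∑ v, ∑ b, if G.proj u v b = some a then (G.μc u v : ℂ) • B v b else 0

/-- The matrix `Σ_u μ(u) Σ_a conj(B_u^a) ⊗ B_u^a`. -/
def sqMat {d : ℕ} (B : G.V → G.B → Mat d) :
    Matrix (Fin d × Fin d) (Fin d × Fin d) ℂ :=
  ∑ u, (G.μL u : ℂ) • ∑ a, mconj (G.Bop B u a) ⊗ₖ G.Bop B u a

/-- The square norm `‖G‖*`. -/
noncomputable def sqNorm : ℝ :=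
  sSup { x | ∃ (d : ℕ) (B : G.V → G.B → Mat d), G.IsStrategyB B ∧
    x = Real.sqrt (opNorm (G.sqMat B)) }

/-- A vector quantum strategy over the finite measured space `Fin n`. -/
def IsVecStrategy {n d : ℕ} (A : Fin n → G.V → G.B → Mat d) : Prop :=
  ∀ i v, (∀ b, (A i v b).PosSemidef) ∧ ((1 : Mat d) - ∑ b, A i v b).PosSemidef

/-- The matrix `E_ω conj(A_{ωv}) ⊗ A_{ωv}` at a fixed `v`. -/
def vecMatAt {n d : ℕ} (w : Fin n → ℝ) (A : Fin n → G.V → G.B → Mat d) (v : G.V) :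
    Matrix (Fin d × Fin d) (Fin d × Fin d) ℂ :=
  ∑ i, (w i : ℂ) • (mconj (∑ b, A i v b) ⊗ₖ (∑ b, A i v b))

/-- The matrix appearing in the definition of `val₊*`. -/
def vecMat {n d : ℕ} (w : Fin n → ℝ) (A : Fin n → G.V → G.B → Mat d) :
    Matrix (Fin d × Fin d) (Fin d × Fin d) ℂ :=
  ∑ i, (w i : ℂ) • ∑ u, (G.μL u : ℂ) • ∑ a, ∑ v, ∑ v',
    ((G.μc u v * G.μc u v' : ℝ) : ℂ) • ∑ b, ∑ b',
      if G.proj u v b = some a ∧ G.proj u v' b' = some a then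
        mconj (A i v b) ⊗ₖ A i v' b' else 0

/-- The relaxed value `val₊*(G)`. -/
noncomputable def valPlus : ℝ :=
  sSup { x | ∃ (n d : ℕ) (w : Fin n → ℝ) (A : Fin n → G.V → G.B → Mat d),
    (∀ i, 0 < w i) ∧ G.IsVecStrategy A ∧
    (∀ v, Real.sqrt (opNorm (G.vecMatAt w A v)) ≤ 1) ∧
    x = opNorm (G.vecMat w A) }

/-- The product of two projection games. -/
def prod (H : ProjGame) : ProjGame where
  U := G.U × H.U
  V := G.V × H.V
  A := G.A × H.A
  B := G.B × H.B
  fU := inferInstance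
  fV := inferInstance
  fA := inferInstance
  fB := inferInstance
  dA := inferInstance
  μ := fun p q => G.μ p.1 q.1 * H.μ p.2 q.2
  μ_nonneg := fun p q => mul_nonneg (G.μ_nonneg _ _) (H.μ_nonneg _ _)
  μ_sum := by
    have h1 := G.μ_sum
    have h2 := H.μ_sum
    calc ∑ p : G.U × H.U, ∑ q : G.V × H.V, G.μ p.1 q.1 * H.μ p.2 q.2
        = ∑ p : G.U × H.U, (∑ v, G.μ p.1 v) * (∑ v', H.μ p.2 v') := by
          refine Finset.sum_congr rfl fun p _ => ?_
          rw [Fintype.sum_prod_type, Finset.sum_mul_sum]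
      _ = (∑ u, ∑ v, G.μ u v) * (∑ u', ∑ v', H.μ u' v') := by
          rw [Fintype.sum_prod_type, Finset.sum_mul_sum]
      _ = 1 := by rw [h1, h2, one_mul]
  proj := fun p q b =>
    (G.proj p.1 q.1 b.1).bind fun a => (H.proj p.2 q.2 b.2).map fun a' => (a, a')

/-- The `k`-fold repetition `G^{⊗k}` (junk value `G` at `k = 0`). -/
def pow : ℕ → ProjGame
  | 0 => G
  | 1 => G
  | (n+2) => G.prod (pow (n+1))

/-- The normalized Laplacian of the square of the constraint graph of `G`. -/
def lap [DecidableEq G.V] : Matrix G.V G.V ℝ :=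
  1 - Matrix.of fun v v' =>
    (Real.sqrt (G.μR v))⁻¹ * (∑ u, G.μL u * G.μc u v * G.μc u v') * (Real.sqrt (G.μR v'))⁻¹

end ProjGame

section MatrixLemmas

open scoped MatrixOrder Matrix.Norms.L2Operator in
theorem Matrix.PosSemidef.exists_eq_conjTranspose_mul_self {ι : Type*} [Fintype ι]
    {X : Matrix ι ι ℂ} (hX : X.PosSemidef) : ∃ B : Matrix ι ι ℂ, X = Bᴴ * B := by
  classical
  exact CStarAlgebra.nonneg_iff_eq_star_mul_self.mp hX.nonneg

theorem Matrix.PosSemidef.sum_univ {ι β : Type*} [Fintype β] {X : β → Matrix ι ι ℂ}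
    (hX : ∀ b, (X b).PosSemidef) : (∑ b, X b).PosSemidef :=
  Matrix.posSemidef_sum _ fun b _ => hX b

theorem Matrix.PosSemidef.smul_real {ι : Type*} {X : Matrix ι ι ℂ} (hX : X.PosSemidef) {c : ℝ}
    (hc : 0 ≤ c) : ((c : ℂ) • X).PosSemidef :=
  hX.smul (by exact_mod_cast hc)

theorem Matrix.PosSemidef.ite_zero {ι : Type*} {X : Matrix ι ι ℂ} (hX : X.PosSemidef) (p : Prop)
    [Decidable p] : (if p then X else 0).PosSemidef := by
  split_ifs
  · exact hX
  · exact Matrix.PosSemidef.zero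

theorem sub_posSemidef_of_sub_sum {ι α : Type*} [Fintype α] {X : α → Matrix ι ι ℂ}
    {L : Matrix ι ι ℂ} (hX : ∀ a, (X a).PosSemidef) (hsum : (L - ∑ a, X a).PosSemidef)
    (a : α) : (L - X a).PosSemidef := by
  classical
  have h : L - X a = (L - ∑ a, X a) + ∑ b ∈ Finset.univ.erase a, X b := by
    rw [← Finset.add_sum_erase _ _ (Finset.mem_univ a)]; abel
  rw [h]
  exact hsum.add (Matrix.posSemidef_sum _ fun b _ => hX b)

variable {ι : Type*} [Fintype ι]

/-- Squared Frobenius norm. -/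
def frobSq (X : Matrix ι ι ℂ) : ℝ := ∑ i, ∑ j, ‖X i j‖ ^ 2

/-- The real bilinear pairing `Re Tr (X Y)`. -/
def reTr (X Y : Matrix ι ι ℂ) : ℝ := (trace (X * Y)).re

theorem frobSq_nonneg (X : Matrix ι ι ℂ) : 0 ≤ frobSq X :=
  Finset.sum_nonneg fun _ _ => Finset.sum_nonneg fun _ _ => by positivity

theorem frobSq_eq_reTr_conjTranspose (X : Matrix ι ι ℂ) : frobSq X = reTr Xᴴ X := by
  simp only [frobSq, reTr, trace, diag_apply, mul_apply, conjTranspose_apply, Complex.re_sum]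
  rw [Finset.sum_comm]
  refine Finset.sum_congr rfl fun i _ => Finset.sum_congr rfl fun j _ => ?_
  rw [← Complex.normSq_eq_norm_sq, Complex.normSq_apply]
  simp [Complex.mul_re]

theorem frobSq_eq_reTr {X : Matrix ι ι ℂ} (hX : X.IsHermitian) : frobSq X = reTr X X := by
  rw [frobSq_eq_reTr_conjTranspose, hX.eq]

theorem frobSq_neg (X : Matrix ι ι ℂ) : frobSq (-X) = frobSq X := by simp [frobSq]

theorem frobSq_sub_comm (X Y : Matrix ι ι ℂ) : frobSq (X - Y) = frobSq (Y - X) := by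
  rw [← frobSq_neg, neg_sub]

theorem frobSq_conjTranspose (X : Matrix ι ι ℂ) : frobSq Xᴴ = frobSq X := by
  simp only [frobSq, conjTranspose_apply, norm_star]
  exact Finset.sum_comm

theorem reTr_comm (X Y : Matrix ι ι ℂ) : reTr X Y = reTr Y X := by
  rw [reTr, trace_mul_comm, reTr]

theorem reTr_add_left (X Y Z : Matrix ι ι ℂ) : reTr (X + Y) Z = reTr X Z + reTr Y Z := by
  simp [reTr, add_mul]

theorem reTr_add_right (X Y Z : Matrix ι ι ℂ) : reTr X (Y + Z) = reTr X Y + reTr X Z := by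
  simp [reTr, mul_add]

theorem reTr_sub_left (X Y Z : Matrix ι ι ℂ) : reTr (X - Y) Z = reTr X Z - reTr Y Z := by
  simp [reTr, sub_mul]

theorem reTr_sub_right (X Y Z : Matrix ι ι ℂ) : reTr X (Y - Z) = reTr X Y - reTr X Z := by
  simp [reTr, mul_sub]

theorem reTr_sum_left {β : Type*} (s : Finset β) (X : β → Matrix ι ι ℂ) (Z : Matrix ι ι ℂ) :
    reTr (∑ b ∈ s, X b) Z = ∑ b ∈ s, reTr (X b) Z := by
  simp [reTr, Finset.sum_mul, trace_sum]

theorem reTr_sum_right {β : Type*} (s : Finset β) (X : β → Matrix ι ι ℂ) (Z : Matrix ι ι ℂ) :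
    reTr Z (∑ b ∈ s, X b) = ∑ b ∈ s, reTr Z (X b) := by
  simp [reTr, Finset.mul_sum, trace_sum]

theorem reTr_smul_left (c : ℝ) (X Y : Matrix ι ι ℂ) :
    reTr ((c : ℂ) • X) Y = c * reTr X Y := by
  simp [reTr]

theorem reTr_smul_right (c : ℝ) (X Y : Matrix ι ι ℂ) :
    reTr X ((c : ℂ) • Y) = c * reTr X Y := by
  simp [reTr]

theorem frobSq_sub {X Y : Matrix ι ι ℂ} (hX : X.IsHermitian) (hY : Y.IsHermitian) :
    frobSq (X - Y) = frobSq X + frobSq Y - 2 * reTr X Y := by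
  rw [frobSq_eq_reTr (hX.sub hY), frobSq_eq_reTr hX, frobSq_eq_reTr hY, reTr_sub_left,
    reTr_sub_right, reTr_sub_right, reTr_comm Y X]
  ring

theorem reTr_nonneg {X Y : Matrix ι ι ℂ} (hX : X.PosSemidef) (hY : Y.PosSemidef) :
    0 ≤ reTr X Y := by
  obtain ⟨B, rfl⟩ := hX.exists_eq_conjTranspose_mul_self
  rw [reTr, Matrix.mul_assoc, trace_mul_comm, Matrix.mul_assoc, ← Matrix.mul_assoc]
  exact (Complex.le_def.mp (hY.mul_mul_conjTranspose_same B).trace_nonneg).1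

theorem frobSq_add_le (X Y Z W : Matrix ι ι ℂ) :
    frobSq (X + Y + Z + W) ≤ 4 * (frobSq X + frobSq Y + frobSq Z + frobSq W) := by
  simp only [frobSq, Finset.mul_sum, ← Finset.sum_add_distrib]
  refine Finset.sum_le_sum fun i _ => Finset.sum_le_sum fun j _ => ?_
  have h : ‖(X + Y + Z + W) i j‖ ≤ ‖X i j‖ + ‖Y i j‖ + ‖Z i j‖ + ‖W i j‖ := by
    simp only [Matrix.add_apply]
    exact (norm_add_le _ _).trans (add_le_add ((norm_add_le _ _).trans
      (add_le_add (norm_add_le _ _) le_rfl)) le_rfl)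
  nlinarith [norm_nonneg ((X + Y + Z + W) i j), sq_nonneg (‖X i j‖ - ‖Y i j‖),
    sq_nonneg (‖X i j‖ - ‖Z i j‖), sq_nonneg (‖X i j‖ - ‖W i j‖), sq_nonneg (‖Y i j‖ - ‖Z i j‖),
    sq_nonneg (‖Y i j‖ - ‖W i j‖), sq_nonneg (‖Z i j‖ - ‖W i j‖), norm_nonneg (X i j),
    norm_nonneg (Y i j), norm_nonneg (Z i j), norm_nonneg (W i j)]

/-- If `X a ≥ 0` and `∑ X a ≤ 1`, then `∑ (X a)² ≤ 1`, tested against `Y`. -/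
theorem sum_frobSq_mul_le [DecidableEq ι] {α : Type*} [Fintype α] {X : α → Matrix ι ι ℂ}
    (hX : ∀ a, (X a).PosSemidef) (hsum : (1 - ∑ a, X a).PosSemidef) (Y : Matrix ι ι ℂ) :
    ∑ a, frobSq (X a * Y) ≤ frobSq Y := by
  have hYY : (Y * Yᴴ).PosSemidef := posSemidef_self_mul_conjTranspose Y
  have key : ∀ a, frobSq (X a * Y) ≤ reTr (X a) (Y * Yᴴ) := by
    intro a
    have h1 : (1 - X a).PosSemidef := sub_posSemidef_of_sub_sum hX hsum a
    have h3 : (X a - X a * X a).PosSemidef := by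
      have h5 : X a - X a * X a = (1 - X a) * X a * (1 - X a)ᴴ + X a * (1 - X a) * (X a)ᴴ := by
        rw [h1.1.eq, (hX a).1.eq]
        noncomm_ring
      rw [h5]
      exact ((hX a).mul_mul_conjTranspose_same _).add (h1.mul_mul_conjTranspose_same _)
    have h6 := reTr_nonneg h3 hYY
    rw [reTr_sub_left] at h6
    have h7 : frobSq (X a * Y) = reTr (X a * X a) (Y * Yᴴ) := by
      rw [frobSq_eq_reTr_conjTranspose, conjTranspose_mul, (hX a).1.eq, reTr, reTr]
      congr 1
      rw [Matrix.mul_assoc, trace_mul_comm]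
      simp only [Matrix.mul_assoc]
    linarith
  have h8 := reTr_nonneg hsum hYY
  rw [reTr_sub_left, reTr_sum_left] at h8
  have h9 : reTr 1 (Y * Yᴴ) = frobSq Y := by
    rw [frobSq_eq_reTr_conjTranspose, reTr_comm Yᴴ, reTr, Matrix.one_mul, reTr]
  linarith [Finset.sum_le_sum fun a (_ : a ∈ Finset.univ) => key a]

theorem sum_reTr_le {α : Type*} [Fintype α] {X Y : α → Matrix ι ι ℂ} {S T : Matrix ι ι ℂ}
    (hX : ∀ a, (X a).PosSemidef) (hY : ∀ a, (Y a).PosSemidef)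
    (hS : (S - ∑ a, X a).PosSemidef) (hT : (T - ∑ a, Y a).PosSemidef) :
    ∑ a, reTr (X a) (Y a) ≤ reTr S T := by
  have h1 : ∀ a, reTr (X a) (Y a) ≤ reTr (X a) T := fun a => by
    have h := reTr_nonneg (hX a) (sub_posSemidef_of_sub_sum hY hT a)
    rw [reTr_sub_right] at h
    linarith
  have hT0 : T.PosSemidef := by
    have h := hT.add (Matrix.PosSemidef.sum_univ hY)
    rwa [sub_add_cancel] at h
  have h2 := reTr_nonneg hS hT0
  rw [reTr_sub_left, reTr_sum_left] at h2
  linarith [Finset.sum_le_sum fun a (_ : a ∈ Finset.univ) => h1 a]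

end MatrixLemmas

section Spectral

variable {ι : Type*} [Fintype ι] [DecidableEq ι]

/-- The Hermitian matrix with eigenbasis `U` and eigenvalues `f`. -/
def spec (U : Matrix ι ι ℂ) (f : ι → ℝ) : Matrix ι ι ℂ :=
  U * diagonal (fun i => (f i : ℂ)) * Uᴴ

theorem Matrix.IsHermitian.exists_eq_spec {X : Matrix ι ι ℂ} (hX : X.IsHermitian) :
    ∃ U ∈ unitaryGroup ι ℂ, X = spec U hX.eigenvalues := by
  refine ⟨hX.eigenvectorUnitary, hX.eigenvectorUnitary.2, ?_⟩
  conv_lhs => rw [hX.spectral_theorem]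
  rfl

variable {U V : Matrix ι ι ℂ}

theorem conjTranspose_mul_self_of_unitary (hU : U ∈ unitaryGroup ι ℂ) : Uᴴ * U = 1 :=
  (mem_unitaryGroup_iff').mp hU

theorem mul_conjTranspose_self_of_unitary (hU : U ∈ unitaryGroup ι ℂ) : U * Uᴴ = 1 :=
  (mem_unitaryGroup_iff).mp hU

theorem spec_mul_spec (hU : U ∈ unitaryGroup ι ℂ) (f g : ι → ℝ) :
    spec U f * spec U g = spec U (fun i => f i * g i) := by
  have h : U * diagonal (fun i => (f i : ℂ)) * Uᴴ * (U * diagonal (fun i => (g i : ℂ)) * Uᴴ)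
      = U * diagonal (fun i => (f i : ℂ)) * (Uᴴ * U) * diagonal (fun i => (g i : ℂ)) * Uᴴ := by
    simp only [Matrix.mul_assoc]
  rw [spec, spec, h, conjTranspose_mul_self_of_unitary hU, Matrix.mul_one,
    Matrix.mul_assoc U, diagonal_mul_diagonal, spec]
  simp

theorem spec_one (hU : U ∈ unitaryGroup ι ℂ) : spec U (fun _ => 1) = 1 := by
  simp [spec, mul_conjTranspose_self_of_unitary hU]

theorem spec_zero : spec U (fun _ => 0) = 0 := by
  simp [spec]

theorem spec_sub (f g : ι → ℝ) : spec U f - spec U g = spec U (fun i => f i - g i) := by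
  rw [spec, spec, spec, ← Matrix.sub_mul, ← Matrix.mul_sub, diagonal_sub]
  simp

theorem spec_isHermitian (f : ι → ℝ) : (spec U f).IsHermitian := by
  rw [spec, IsHermitian, conjTranspose_mul, conjTranspose_mul, conjTranspose_conjTranspose,
    diagonal_conjTranspose, Matrix.mul_assoc]
  congr 3
  ext i
  simp

theorem spec_posSemidef {f : ι → ℝ} (hf : ∀ i, 0 ≤ f i) : (spec U f).PosSemidef :=
  (PosSemidef.diagonal (fun i => by simpa using hf i)).mul_mul_conjTranspose_same U

theorem spec_mul_mul_spec_posSemidef {X : Matrix ι ι ℂ} (hX : X.PosSemidef) (f : ι → ℝ) :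
    (spec U f * X * spec U f).PosSemidef := by
  have h := hX.mul_mul_conjTranspose_same (spec U f)
  rwa [(spec_isHermitian f).eq] at h

theorem conjTranspose_mul_spec (hU : U ∈ unitaryGroup ι ℂ) (f : ι → ℝ) :
    Uᴴ * spec U f = diagonal (fun i => (f i : ℂ)) * Uᴴ := by
  rw [spec, ← Matrix.mul_assoc, ← Matrix.mul_assoc, conjTranspose_mul_self_of_unitary hU,
    Matrix.one_mul]

theorem spec_mul_unitary (hU : U ∈ unitaryGroup ι ℂ) (f : ι → ℝ) :
    spec U f * U = U * diagonal (fun i => (f i : ℂ)) := by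
  rw [spec, Matrix.mul_assoc, conjTranspose_mul_self_of_unitary hU, Matrix.mul_one]

theorem frobSq_unitary (hU : U ∈ unitaryGroup ι ℂ) (hV : V ∈ unitaryGroup ι ℂ)
    (X : Matrix ι ι ℂ) : frobSq (Uᴴ * X * V) = frobSq X := by
  rw [frobSq_eq_reTr_conjTranspose, frobSq_eq_reTr_conjTranspose, reTr, reTr]
  congr 1
  have h : (Uᴴ * X * V)ᴴ * (Uᴴ * X * V) = Vᴴ * (Xᴴ * (U * Uᴴ) * X * V) := by
    simp only [conjTranspose_mul, conjTranspose_conjTranspose, Matrix.mul_assoc]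
  rw [h, mul_conjTranspose_self_of_unitary hU, trace_mul_comm, Matrix.mul_assoc (_ * X),
    mul_conjTranspose_self_of_unitary hV, Matrix.mul_one, Matrix.mul_one]

theorem frobSq_spec_mul_sub (hU : U ∈ unitaryGroup ι ℂ) (hV : V ∈ unitaryGroup ι ℂ)
    (f g : ι → ℝ) (X : Matrix ι ι ℂ) :
    frobSq (spec U f * X - X * spec V g)
      = ∑ i, ∑ j, (f i - g j) ^ 2 * ‖(Uᴴ * X * V) i j‖ ^ 2 := by
  have h : Uᴴ * (spec U f * X - X * spec V g) * V
      = diagonal (fun i => (f i : ℂ)) * (Uᴴ * X * V)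
        - (Uᴴ * X * V) * diagonal (fun i => (g i : ℂ)) := by
    rw [Matrix.mul_sub, Matrix.sub_mul, ← Matrix.mul_assoc, conjTranspose_mul_spec hU,
      Matrix.mul_assoc Uᴴ (X * _), Matrix.mul_assoc X, spec_mul_unitary hV]
    simp only [Matrix.mul_assoc]
  rw [← frobSq_unitary hU hV, h, frobSq]
  refine Finset.sum_congr rfl fun i _ => Finset.sum_congr rfl fun j _ => ?_
  rw [Matrix.sub_apply, diagonal_mul, mul_diagonal, mul_comm _ (g j : ℂ), ← sub_mul,
    ← Complex.ofReal_sub, norm_mul, mul_pow, Complex.norm_real, Real.norm_eq_abs, sq_abs]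

theorem frobSq_spec_mul (hU : U ∈ unitaryGroup ι ℂ) (hV : V ∈ unitaryGroup ι ℂ)
    (f : ι → ℝ) (X : Matrix ι ι ℂ) :
    frobSq (spec U f * X) = ∑ i, ∑ j, f i ^ 2 * ‖(Uᴴ * X * V) i j‖ ^ 2 := by
  have h := frobSq_spec_mul_sub hU hV f (fun _ => 0) X
  simpa [spec_zero] using h

theorem frobSq_mul_spec (hU : U ∈ unitaryGroup ι ℂ) (hV : V ∈ unitaryGroup ι ℂ)
    (g : ι → ℝ) (X : Matrix ι ι ℂ) :
    frobSq (X * spec V g) = ∑ i, ∑ j, g j ^ 2 * ‖(Uᴴ * X * V) i j‖ ^ 2 := by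
  have h := frobSq_spec_mul_sub hU hV (fun _ => 0) g X
  rw [spec_zero, Matrix.zero_mul, zero_sub, frobSq_neg] at h
  simpa using h

theorem frobSq_eq_sum_unitary (hU : U ∈ unitaryGroup ι ℂ) (hV : V ∈ unitaryGroup ι ℂ)
    (X : Matrix ι ι ℂ) : frobSq X = ∑ i, ∑ j, ‖(Uᴴ * X * V) i j‖ ^ 2 := by
  rw [← frobSq_unitary hU hV, frobSq]

theorem frobSq_spec (hU : U ∈ unitaryGroup ι ℂ) (f : ι → ℝ) :
    frobSq (spec U f) = ∑ i, f i ^ 2 := by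
  have h := frobSq_spec_mul hU hU f 1
  rw [Matrix.mul_one, Matrix.mul_one, conjTranspose_mul_self_of_unitary hU] at h
  rw [h]
  refine Finset.sum_congr rfl fun i _ => ?_
  rw [Finset.sum_eq_single i]
  · simp
  · intro j _ hj
    simp [one_apply_ne hj.symm]
  · simp

theorem frobSq_mul_spec_le (hU : U ∈ unitaryGroup ι ℂ) {f : ι → ℝ} (hf : ∀ i, f i ^ 2 ≤ 1)
    (X : Matrix ι ι ℂ) : frobSq (X * spec U f) ≤ frobSq X := by
  rw [frobSq_mul_spec hU hU, frobSq_eq_sum_unitary hU hU X]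
  exact Finset.sum_le_sum fun i _ => Finset.sum_le_sum fun j _ =>
    mul_le_of_le_one_left (by positivity) (hf j)

theorem trace_spec_re (hU : U ∈ unitaryGroup ι ℂ) (f : ι → ℝ) :
    (trace (spec U f)).re = ∑ i, f i := by
  rw [spec, trace_mul_comm, ← Matrix.mul_assoc, conjTranspose_mul_self_of_unitary hU,
    Matrix.one_mul, trace_diagonal]
  simp

end Spectral

section Threshold

/-- The `k`-th of `n` threshold indicators of `x²`. -/
def thr (n k : ℕ) (x : ℝ) : ℝ := if ((k : ℝ) + 1 ≤ n * x ^ 2) then 1 else 0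

theorem thr_sq (n k : ℕ) (x : ℝ) : thr n k x ^ 2 = thr n k x := by
  unfold thr; split_ifs <;> simp

theorem thr_sq_le_one (n k : ℕ) (x : ℝ) : thr n k x ^ 2 ≤ 1 := by
  unfold thr; split_ifs <;> simp

theorem thr_zero (n k : ℕ) : thr n k 0 = 0 := by
  have h : ¬ ((k : ℝ) + 1 ≤ n * 0 ^ 2) := by
    have : (0 : ℝ) ≤ k := k.cast_nonneg
    norm_num
    linarith
  rw [thr, if_neg h]

theorem thr_mono (n k : ℕ) {x y : ℝ} (h : x ^ 2 ≤ y ^ 2) : thr n k x ≤ thr n k y := by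
  unfold thr
  have h' : (n : ℝ) * x ^ 2 ≤ n * y ^ 2 := mul_le_mul_of_nonneg_left h n.cast_nonneg
  split_ifs <;> linarith

theorem sum_thr {n : ℕ} {x : ℝ} (hx : x ^ 2 ≤ 1) :
    ∑ k : Fin n, thr n k x = ⌊n * x ^ 2⌋₊ := by
  have hle : ⌊n * x ^ 2⌋₊ ≤ n := by
    apply Nat.floor_le_of_le
    exact mul_le_of_le_one_right n.cast_nonneg hx
  have h0 : (0 : ℝ) ≤ n * x ^ 2 := by positivity
  have h1 : ∀ k : ℕ, thr n k x = if k < ⌊n * x ^ 2⌋₊ then (1 : ℝ) else 0 := by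
    intro k
    unfold thr
    congr 1
    rw [← Nat.succ_le_iff, Nat.le_floor_iff h0]
    simp
  rw [Fin.sum_univ_eq_sum_range (fun k => thr n k x), Finset.sum_congr rfl fun k _ => h1 k,
    Finset.sum_ite, Finset.sum_const_zero, add_zero, Finset.sum_const, nsmul_one]
  congr 1
  have h2 : (Finset.range n).filter (fun k => k < ⌊n * x ^ 2⌋₊) = Finset.range ⌊n * x ^ 2⌋₊ := by
    ext k
    simp only [Finset.mem_filter, Finset.mem_range]
    omega
  rw [h2, Finset.card_range]

theorem sum_thr_le {n : ℕ} {x : ℝ} (hx : x ^ 2 ≤ 1) :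
    ∑ k : Fin n, thr n k x ≤ n * x ^ 2 := by
  rw [sum_thr hx]
  exact Nat.floor_le (by positivity)

theorem le_sum_thr {n : ℕ} {x : ℝ} (hx : x ^ 2 ≤ 1) :
    n * x ^ 2 - 1 ≤ ∑ k : Fin n, thr n k x := by
  rw [sum_thr hx]
  exact (Nat.sub_one_lt_floor _).le

theorem sum_thr_sub_sq_le {n : ℕ} {x y θ : ℝ} (hθ : 0 < θ) (hx : x ^ 2 ≤ 1) (hy : y ^ 2 ≤ 1) :
    ∑ k : Fin n, (thr n k x - thr n k y) ^ 2
      ≤ n * ((x - y) ^ 2 / (2 * θ) + θ * (x ^ 2 + y ^ 2)) + 1 := by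
  wlog hxy : x ^ 2 ≤ y ^ 2 generalizing x y
  · have h := this hy hx (not_le.mp hxy).le
    calc _ = ∑ k : Fin n, (thr n k y - thr n k x) ^ 2 :=
          Finset.sum_congr rfl fun k _ => by ring
      _ ≤ _ := h
      _ = _ := by ring
  have h1 : ∀ k : ℕ, (thr n k x - thr n k y) ^ 2 = thr n k y - thr n k x := by
    intro k
    have h2 := thr_mono n k hxy
    unfold thr at h2 ⊢
    split_ifs at h2 ⊢ <;> first | (norm_num; done) | linarith
  rw [Finset.sum_congr rfl fun (k : Fin n) _ => h1 k, Finset.sum_sub_distrib]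
  have h3 := sum_thr_le (n := n) hy
  have h4 := le_sum_thr (n := n) hx
  have h5 : y ^ 2 - x ^ 2 ≤ (x - y) ^ 2 / (2 * θ) + θ * (x ^ 2 + y ^ 2) := by
    have h6 : (x - y) ^ 2 / (2 * θ) + θ * (x ^ 2 + y ^ 2) - (y ^ 2 - x ^ 2)
        = ((y - x) - θ * (x + y)) ^ 2 / (2 * θ) + θ * (x - y) ^ 2 / 2 := by
      field_simp
      ring
    have h7 : 0 ≤ ((y - x) - θ * (x + y)) ^ 2 / (2 * θ) + θ * (x - y) ^ 2 / 2 := by positivity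
    linarith
  have h8 : (n : ℝ) * (y ^ 2 - x ^ 2) ≤ n * ((x - y) ^ 2 / (2 * θ) + θ * (x ^ 2 + y ^ 2)) :=
    mul_le_mul_of_nonneg_left h5 n.cast_nonneg
  linarith

variable {ι : Type*} [Fintype ι] [DecidableEq ι] {U V : Matrix ι ι ℂ}

/-- Connes' joint distribution trick, discretised: spectral projections almost intertwine
whenever the matrices do. -/
theorem sum_frobSq_thr_sub_le (hU : U ∈ unitaryGroup ι ℂ) (hV : V ∈ unitaryGroup ι ℂ)
    {f g : ι → ℝ} (hf : ∀ i, f i ^ 2 ≤ 1) (hg : ∀ i, g i ^ 2 ≤ 1) {θ : ℝ} (hθ : 0 < θ) (n : ℕ)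
    (X : Matrix ι ι ℂ) :
    ∑ k : Fin n, frobSq (spec U (fun i => thr n k (f i)) * X - X * spec V fun i => thr n k (g i))
      ≤ n * (frobSq (spec U f * X - X * spec V g) / (2 * θ)
          + θ * (frobSq (spec U f * X) + frobSq (X * spec V g))) + frobSq X := by
  simp only [frobSq_spec_mul_sub hU hV]
  rw [frobSq_spec_mul hU hV, frobSq_mul_spec hU hV, frobSq_eq_sum_unitary hU hV X,
    Finset.sum_comm]
  simp only [Finset.sum_comm (s := (Finset.univ : Finset (Fin n))), ← Finset.sum_mul]
  simp only [Finset.mul_sum, Finset.sum_div, ← Finset.sum_add_distrib]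
  refine Finset.sum_le_sum fun i _ => Finset.sum_le_sum fun j _ => ?_
  refine (mul_le_mul_of_nonneg_right (sum_thr_sub_sq_le (n := n) hθ (hf i) (hg j))
    (by positivity)).trans (le_of_eq ?_)
  ring

theorem sum_frobSq_mul_thr_le (hV : V ∈ unitaryGroup ι ℂ) {g : ι → ℝ} (hg : ∀ i, g i ^ 2 ≤ 1)
    (n : ℕ) (X : Matrix ι ι ℂ) :
    ∑ k : Fin n, frobSq (X * spec V fun i => thr n k (g i)) ≤ n * frobSq (X * spec V g) := by
  simp only [frobSq_mul_spec hV hV, thr_sq]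
  rw [Finset.sum_comm]
  simp only [Finset.sum_comm (s := (Finset.univ : Finset (Fin n))), ← Finset.sum_mul]
  simp only [Finset.mul_sum]
  refine Finset.sum_le_sum fun i _ => Finset.sum_le_sum fun j _ => ?_
  refine (mul_le_mul_of_nonneg_right (sum_thr_le (n := n) (hg j))
    (by positivity)).trans (le_of_eq ?_)
  ring

theorem le_sum_frobSq_mul_thr (hV : V ∈ unitaryGroup ι ℂ) {g : ι → ℝ} (hg : ∀ i, g i ^ 2 ≤ 1)
    (n : ℕ) (X : Matrix ι ι ℂ) :
    n * frobSq (X * spec V g) - frobSq X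
      ≤ ∑ k : Fin n, frobSq (X * spec V fun i => thr n k (g i)) := by
  rw [frobSq_eq_sum_unitary hV hV X]
  simp only [frobSq_mul_spec hV hV, thr_sq]
  rw [Finset.sum_comm (s := (Finset.univ : Finset (Fin n)))]
  simp only [Finset.sum_comm (s := (Finset.univ : Finset (Fin n))), ← Finset.sum_mul]
  simp only [Finset.mul_sum, ← Finset.sum_sub_distrib]
  refine Finset.sum_le_sum fun i _ => Finset.sum_le_sum fun j _ => ?_
  refine le_trans (le_of_eq ?_) (mul_le_mul_of_nonneg_right (le_sum_thr (n := n) (hg j))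
    (by positivity))
  ring

end Threshold

section Compression

variable {ι : Type*} [Fintype ι] [DecidableEq ι] {U V : Matrix ι ι ℂ}

/-- Inverse square roots of the eigenvalues (zero on the kernel). -/
def invSqrt (lam : ι → ℝ) (i : ι) : ℝ := (√(lam i))⁻¹

/-- `L^{-1/2} X L^{-1/2}` for `L = spec U lam`. -/
def normalized (U : Matrix ι ι ℂ) (lam : ι → ℝ) (X : Matrix ι ι ℂ) : Matrix ι ι ℂ :=
  spec U (invSqrt lam) * X * spec U (invSqrt lam)

/-- The `k`-th threshold projection of `L = spec U lam`. -/
def thrProj (U : Matrix ι ι ℂ) (lam : ι → ℝ) (n k : ℕ) : Matrix ι ι ℂ :=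
  spec U fun i => thr n k (lam i)

/-- The compression of `L^{-1/2} X L^{-1/2}` to the `k`-th threshold projection of `L`. -/
def compressed (U : Matrix ι ι ℂ) (lam : ι → ℝ) (n k : ℕ) (X : Matrix ι ι ℂ) : Matrix ι ι ℂ :=
  thrProj U lam n k * (normalized U lam X * thrProj U lam n k)

theorem compressed_eq (hU : U ∈ unitaryGroup ι ℂ) (lam : ι → ℝ) (n k : ℕ) (X : Matrix ι ι ℂ) :
    compressed U lam n k X = spec U (fun i => thr n k (lam i) * invSqrt lam i) * X
      * spec U (fun i => thr n k (lam i) * invSqrt lam i) := by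
  have h : (fun i => thr n k (lam i) * invSqrt lam i)
      = fun i => invSqrt lam i * thr n k (lam i) := funext fun i => mul_comm _ _
  rw [← spec_mul_spec hU, compressed, normalized, thrProj]
  simp only [Matrix.mul_assoc]
  rw [spec_mul_spec hU, spec_mul_spec hU, h]

theorem compressed_posSemidef (hU : U ∈ unitaryGroup ι ℂ) (lam : ι → ℝ) (n k : ℕ)
    {X : Matrix ι ι ℂ} (hX : X.PosSemidef) : (compressed U lam n k X).PosSemidef := by
  rw [compressed_eq hU]
  exact spec_mul_mul_spec_posSemidef hX _

theorem compressed_sum {β : Type*} (s : Finset β) (lam : ι → ℝ) (n k : ℕ)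
    (X : β → Matrix ι ι ℂ) :
    compressed U lam n k (∑ b ∈ s, X b) = ∑ b ∈ s, compressed U lam n k (X b) := by
  simp only [compressed, normalized, Finset.mul_sum, Finset.sum_mul]

theorem compressed_self (hU : U ∈ unitaryGroup ι ℂ) {lam : ι → ℝ} (h0 : ∀ i, 0 ≤ lam i)
    (n k : ℕ) : compressed U lam n k (spec U lam) = thrProj U lam n k := by
  rw [compressed_eq hU, spec_mul_spec hU, spec_mul_spec hU, thrProj]
  congr 1
  funext i
  rcases (h0 i).eq_or_lt with h | h
  · rw [← h, thr_zero]; simp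
  · have h1 : √(lam i) ≠ 0 := (Real.sqrt_pos.mpr h).ne'
    have h2 : lam i = √(lam i) * √(lam i) := (Real.mul_self_sqrt h.le).symm
    have h3 := thr_sq n k (lam i)
    calc thr n k (lam i) * invSqrt lam i * lam i * (thr n k (lam i) * invSqrt lam i)
        = thr n k (lam i) ^ 2 * (invSqrt lam i * lam i * invSqrt lam i) := by ring
      _ = thr n k (lam i) * ((√(lam i))⁻¹ * (√(lam i) * √(lam i)) * (√(lam i))⁻¹) := by
          rw [h3, invSqrt, ← h2]
      _ = thr n k (lam i) := by field_simp

theorem normalized_posSemidef {X : Matrix ι ι ℂ} (hX : X.PosSemidef) (lam : ι → ℝ) :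
    (normalized U lam X).PosSemidef :=
  spec_mul_mul_spec_posSemidef hX _

theorem one_sub_sum_normalized_posSemidef (hU : U ∈ unitaryGroup ι ℂ) {lam : ι → ℝ}
    (h0 : ∀ i, 0 ≤ lam i) {α : Type*} [Fintype α] {X : α → Matrix ι ι ℂ}
    (hX : (spec U lam - ∑ a, X a).PosSemidef) :
    (1 - ∑ a, normalized U lam (X a)).PosSemidef := by
  have h1 : 1 - ∑ a, normalized U lam (X a)
      = spec U (fun i => 1 - invSqrt lam i * lam i * invSqrt lam i)
        + spec U (invSqrt lam) * (spec U lam - ∑ a, X a) * spec U (invSqrt lam) := by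
    rw [Matrix.mul_sub, Matrix.sub_mul, spec_mul_spec hU, spec_mul_spec hU, ← spec_sub,
      spec_one hU]
    simp only [normalized, Finset.mul_sum, Finset.sum_mul]
    abel
  rw [h1]
  refine (spec_posSemidef fun i => ?_).add (spec_mul_mul_spec_posSemidef hX _)
  rcases (h0 i).eq_or_lt with h | h
  · rw [← h]; simp
  · have h1 : √(lam i) ≠ 0 := (Real.sqrt_pos.mpr h).ne'
    have h2 : lam i = √(lam i) * √(lam i) := (Real.mul_self_sqrt h.le).symm
    have h3 : invSqrt lam i * lam i * invSqrt lam i = 1 := by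
      rw [invSqrt]
      nth_rewrite 2 [h2]
      field_simp
    rw [h3, sub_self]

/-- Recover the entries of `X` (in the eigenbasis of `L ≥ X`) from those of
`L^{-1/2} X L^{-1/2}`. -/
theorem entry_eq_sqrt_mul (hU : U ∈ unitaryGroup ι ℂ) {lam : ι → ℝ} (h0 : ∀ i, 0 ≤ lam i)
    {X : Matrix ι ι ℂ} (hX : X.PosSemidef) (hle : (spec U lam - X).PosSemidef) (i j : ι) :
    (Uᴴ * X * U) i j = √(lam i) * √(lam j) * (Uᴴ * normalized U lam X * U) i j := by
  have hx := hX.conjTranspose_mul_mul_same U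
  have hzero : ∀ i, lam i = 0 → ∀ j, (Uᴴ * X * U) j i = 0 := by
    intro i hi j
    have h1 := (hle.conjTranspose_mul_mul_same U).diag_nonneg (i := i)
    have h2 : Uᴴ * (spec U lam - X) * U = diagonal (fun i => (lam i : ℂ)) - Uᴴ * X * U := by
      rw [Matrix.mul_sub, Matrix.sub_mul, conjTranspose_mul_spec hU, Matrix.mul_assoc,
        conjTranspose_mul_self_of_unitary hU, Matrix.mul_one]
    rw [h2, Matrix.sub_apply, diagonal_apply_eq, hi, Complex.ofReal_zero, zero_sub,
      neg_nonneg] at h1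
    have h3 : (Uᴴ * X * U) i i = 0 := le_antisymm h1 hx.diag_nonneg
    have h4 := (hx.dotProduct_mulVec_zero_iff (Pi.single i 1)).mp (by
      rw [mulVec_single_one, ← Pi.single_star, star_one, single_one_dotProduct]
      exact h3)
    rw [mulVec_single_one] at h4
    exact congrFun h4 j
  have hm : Uᴴ * normalized U lam X * U = diagonal (fun i => (invSqrt lam i : ℂ))
      * (Uᴴ * X * U) * diagonal (fun i => (invSqrt lam i : ℂ)) := by
    rw [normalized, ← Matrix.mul_assoc, ← Matrix.mul_assoc, conjTranspose_mul_spec hU,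
      Matrix.mul_assoc _ _ U, spec_mul_unitary hU]
    simp only [Matrix.mul_assoc]
  rw [hm, mul_diagonal, diagonal_mul]
  rcases (h0 i).eq_or_lt with hi | hi
  · have h5 : (Uᴴ * X * U) i j = 0 := by
      rw [← hx.1.apply i j, hzero i hi.symm j, star_zero]
    rw [h5]; simp
  rcases (h0 j).eq_or_lt with hj | hj
  · rw [hzero j hj.symm i]; simp
  have hi' : (√(lam i) : ℂ) ≠ 0 := by exact_mod_cast (Real.sqrt_pos.mpr hi).ne'
  have hj' : (√(lam j) : ℂ) ≠ 0 := by exact_mod_cast (Real.sqrt_pos.mpr hj).ne'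
  simp only [invSqrt, Complex.ofReal_inv]
  field_simp

theorem frobSq_commutator (hU : U ∈ unitaryGroup ι ℂ) {lam : ι → ℝ} (h0 : ∀ i, 0 ≤ lam i)
    {X : Matrix ι ι ℂ} (hX : X.PosSemidef) (hle : (spec U lam - X).PosSemidef) :
    frobSq (spec U lam * normalized U lam X - normalized U lam X * spec U lam)
      = 2 * (frobSq (normalized U lam X * spec U lam) - frobSq X) := by
  have h1 : frobSq (spec U lam * normalized U lam X)
      = frobSq (normalized U lam X * spec U lam) := by
    rw [← frobSq_conjTranspose, conjTranspose_mul, (spec_isHermitian lam).eq,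
      (normalized_posSemidef hX lam).1.eq]
  have h2 : frobSq (spec U lam * normalized U lam X - normalized U lam X * spec U lam)
      = frobSq (spec U lam * normalized U lam X) + frobSq (normalized U lam X * spec U lam)
        - 2 * frobSq X := by
    rw [frobSq_spec_mul_sub hU hU, frobSq_spec_mul hU hU, frobSq_mul_spec hU hU,
      frobSq_eq_sum_unitary hU hU X]
    simp only [Finset.mul_sum, ← Finset.sum_add_distrib, ← Finset.sum_sub_distrib]
    refine Finset.sum_congr rfl fun i _ => Finset.sum_congr rfl fun j _ => ?_
    rw [entry_eq_sqrt_mul hU h0 hX hle]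
    simp only [norm_mul, mul_pow, Complex.norm_real, Real.norm_eq_abs, sq_abs,
      Real.sq_sqrt (h0 _)]
    ring
  rw [h2, h1]; ring

theorem frobSq_normalized_mul_sub_le (hU : U ∈ unitaryGroup ι ℂ) {lam : ι → ℝ}
    (h0 : ∀ i, 0 ≤ lam i) {X : Matrix ι ι ℂ} (hX : X.PosSemidef)
    (hle : (spec U lam - X).PosSemidef) :
    frobSq (normalized U lam X * spec U lam - X)
      ≤ frobSq (spec U lam * normalized U lam X - normalized U lam X * spec U lam) := by
  rw [frobSq_spec_mul_sub hU hU, frobSq_eq_sum_unitary hU hU]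
  refine Finset.sum_le_sum fun i _ => Finset.sum_le_sum fun j _ => ?_
  have h1 : (Uᴴ * (normalized U lam X * spec U lam - X) * U) i j
      = ((lam j - √(lam i) * √(lam j) : ℝ) : ℂ) * (Uᴴ * normalized U lam X * U) i j := by
    have h2 : Uᴴ * (normalized U lam X * spec U lam - X) * U
        = (Uᴴ * normalized U lam X * U) * diagonal (fun i => (lam i : ℂ)) - Uᴴ * X * U := by
      rw [Matrix.mul_sub, Matrix.sub_mul, Matrix.mul_assoc Uᴴ (_ * _), Matrix.mul_assoc _ _ U,
        spec_mul_unitary hU]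
      simp only [Matrix.mul_assoc]
    rw [h2, Matrix.sub_apply, mul_diagonal, entry_eq_sqrt_mul hU h0 hX hle]
    push_cast
    ring
  rw [h1, norm_mul, mul_pow, Complex.norm_real, Real.norm_eq_abs, sq_abs]
  refine mul_le_mul_of_nonneg_right ?_ (by positivity)
  set x := √(lam i) with hx
  set y := √(lam j) with hy
  have hx0 : 0 ≤ x := Real.sqrt_nonneg _
  have hy0 : 0 ≤ y := Real.sqrt_nonneg _
  rw [← Real.sq_sqrt (h0 i), ← Real.sq_sqrt (h0 j), ← hx, ← hy]
  have h3 : (x ^ 2 - y ^ 2) ^ 2 - (y ^ 2 - x * y) ^ 2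
      = (x - y) ^ 2 * (x ^ 2 + 2 * x * y) := by ring
  have h4 : 0 ≤ (x - y) ^ 2 * (x ^ 2 + 2 * x * y) := by positivity
  linarith

variable {lam mu : ι → ℝ} {α : Type*} [Fintype α] {X Y : α → Matrix ι ι ℂ}

theorem sum_frobSq_normalized_mul_le (hU : U ∈ unitaryGroup ι ℂ) (h0 : ∀ i, 0 ≤ lam i)
    (hX : ∀ a, (X a).PosSemidef) (hsum : (spec U lam - ∑ a, X a).PosSemidef)
    (Z : Matrix ι ι ℂ) : ∑ a, frobSq (normalized U lam (X a) * Z) ≤ frobSq Z :=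
  sum_frobSq_mul_le (fun a => normalized_posSemidef (hX a) lam)
    (one_sub_sum_normalized_posSemidef hU h0 hsum) Z

theorem sum_frobSq_commutator_le (hU : U ∈ unitaryGroup ι ℂ) (h0 : ∀ i, 0 ≤ lam i)
    (h1 : ∑ i, lam i ^ 2 ≤ 1)
    (hX : ∀ a, (X a).PosSemidef) (hsum : (spec U lam - ∑ a, X a).PosSemidef) :
    ∑ a, frobSq (spec U lam * normalized U lam (X a) - normalized U lam (X a) * spec U lam)
      ≤ 2 * (1 - ∑ a, frobSq (X a)) := by
  rw [Finset.sum_congr rfl fun a _ => frobSq_commutator hU h0 (hX a)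
    (sub_posSemidef_of_sub_sum hX hsum a), ← Finset.mul_sum, Finset.sum_sub_distrib]
  have h := sum_frobSq_normalized_mul_le hU h0 hX hsum (spec U lam)
  rw [frobSq_spec hU] at h
  linarith

theorem frobSq_one : frobSq (1 : Matrix ι ι ℂ) = Fintype.card ι := by
  have h : (1 : Matrix ι ι ℂ) ∈ unitaryGroup ι ℂ := one_mem _
  have h2 := frobSq_spec h (fun _ => 1)
  rw [spec_one h] at h2
  simpa using h2

theorem sq_le_one_of_sum {ι : Type*} [Fintype ι] {lam : ι → ℝ} (h1 : ∑ i, lam i ^ 2 ≤ 1) (i : ι) :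
    lam i ^ 2 ≤ 1 :=
  (Finset.single_le_sum (f := fun i => lam i ^ 2) (fun _ _ => sq_nonneg _)
    (Finset.mem_univ i)).trans h1

theorem sum_frobSq_thrProj_commutator_le (hU : U ∈ unitaryGroup ι ℂ) (h0 : ∀ i, 0 ≤ lam i)
    (h1 : ∑ i, lam i ^ 2 ≤ 1)
    (hX : ∀ a, (X a).PosSemidef) (hsum : (spec U lam - ∑ a, X a).PosSemidef)
    {θ : ℝ} (hθ : 0 < θ) (n : ℕ) :
    ∑ a, ∑ k : Fin n, frobSq (thrProj U lam n k * normalized U lam (X a)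
        - normalized U lam (X a) * thrProj U lam n k)
      ≤ n * ((1 - ∑ a, frobSq (X a)) / θ + 2 * θ) + Fintype.card ι := by
  have hl := sq_le_one_of_sum h1
  refine (Finset.sum_le_sum fun a _ => sum_frobSq_thr_sub_le hU hU hl hl hθ n _).trans ?_
  have hc := sum_frobSq_commutator_le hU h0 h1 hX hsum
  have hb := sum_frobSq_normalized_mul_le hU h0 hX hsum (spec U lam)
  rw [frobSq_spec hU] at hb
  have hd := sum_frobSq_normalized_mul_le hU h0 hX hsum 1
  rw [frobSq_one] at hd
  simp only [Matrix.mul_one] at hd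
  have hb' : ∑ a, frobSq (spec U lam * normalized U lam (X a)) ≤ 1 := by
    refine le_trans (le_of_eq ?_) (hb.trans h1)
    refine Finset.sum_congr rfl fun a _ => ?_
    rw [← frobSq_conjTranspose, conjTranspose_mul, (spec_isHermitian lam).eq,
      (normalized_posSemidef (hX a) lam).1.eq]
  simp only [Finset.sum_add_distrib, ← Finset.mul_sum, ← Finset.sum_div]
  refine add_le_add (mul_le_mul_of_nonneg_left (add_le_add ?_ ?_) n.cast_nonneg) hd
  · rw [div_le_div_iff₀ (by positivity) hθ]
    nlinarith
  · nlinarith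

theorem thrProj_mul_self (hU : U ∈ unitaryGroup ι ℂ) (lam : ι → ℝ) (n k : ℕ) :
    thrProj U lam n k * thrProj U lam n k = thrProj U lam n k := by
  rw [thrProj, spec_mul_spec hU]
  simp only [← pow_two, thr_sq]

theorem frobSq_compressed_sub_le (hU : U ∈ unitaryGroup ι ℂ) (lam : ι → ℝ) (n k : ℕ)
    (Z : Matrix ι ι ℂ) :
    frobSq (compressed U lam n k Z - normalized U lam Z * thrProj U lam n k)
      ≤ frobSq (thrProj U lam n k * normalized U lam Z
        - normalized U lam Z * thrProj U lam n k) := by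
  have h : compressed U lam n k Z - normalized U lam Z * thrProj U lam n k
      = (thrProj U lam n k * normalized U lam Z - normalized U lam Z * thrProj U lam n k)
        * thrProj U lam n k := by
    rw [Matrix.sub_mul, Matrix.mul_assoc _ (thrProj U lam n k), thrProj_mul_self hU, compressed,
      Matrix.mul_assoc]
  rw [h]
  exact frobSq_mul_spec_le hU (fun i => thr_sq_le_one n k _) _

theorem frobSq_compressed (hU : U ∈ unitaryGroup ι ℂ) (lam : ι → ℝ) (n k : ℕ)
    (Z : Matrix ι ι ℂ) :
    frobSq (compressed U lam n k Z) = frobSq (normalized U lam Z * thrProj U lam n k)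
      - frobSq (compressed U lam n k Z - normalized U lam Z * thrProj U lam n k) := by
  set W := normalized U lam Z * thrProj U lam n k with hW
  have h1 : compressed U lam n k Z - W
      = spec U (fun i => thr n k (lam i)) * W - W * spec U (fun _ => 1) := by
    rw [spec_one hU, Matrix.mul_one, compressed, thrProj]
    rfl
  have h2 : compressed U lam n k Z = spec U (fun i => thr n k (lam i)) * W := rfl
  rw [h1, h2, frobSq_spec_mul_sub hU hU, frobSq_spec_mul hU hU, frobSq_eq_sum_unitary hU hU W]
  simp only [← Finset.sum_sub_distrib]
  refine Finset.sum_congr rfl fun i _ => Finset.sum_congr rfl fun j _ => ?_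
  have h3 := thr_sq n k (lam i)
  linear_combination (2 * ‖(Uᴴ * W * U) i j‖ ^ 2) * h3

end Compression

section Sampling

variable {ι : Type*} [Fintype ι] [DecidableEq ι] {U V : Matrix ι ι ℂ}
  {lam mu : ι → ℝ} {α : Type*} [Fintype α] {X Y : α → Matrix ι ι ℂ}

theorem sum_frobSq_compressed_sub_le (hU : U ∈ unitaryGroup ι ℂ) (h0 : ∀ i, 0 ≤ lam i)
    (h1 : ∑ i, lam i ^ 2 ≤ 1)
    (hX : ∀ a, (X a).PosSemidef) (hsum : (spec U lam - ∑ a, X a).PosSemidef)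
    {θ : ℝ} (hθ : 0 < θ) {n : ℕ} (hn : Fintype.card ι ≤ n * θ) :
    ∑ a, ∑ k : Fin n, frobSq (compressed U lam n k (X a)
        - normalized U lam (X a) * thrProj U lam n k)
      ≤ n * ((1 - ∑ a, frobSq (X a)) / θ + 3 * θ) := by
  refine (Finset.sum_le_sum fun a _ => Finset.sum_le_sum fun (k : Fin n) _ =>
    frobSq_compressed_sub_le hU lam n k (X a)).trans ?_
  refine (sum_frobSq_thrProj_commutator_le hU h0 h1 hX hsum hθ n).trans ?_
  linarith

theorem le_sum_frobSq_compressed (hU : U ∈ unitaryGroup ι ℂ) (h0 : ∀ i, 0 ≤ lam i)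
    (h1 : ∑ i, lam i ^ 2 ≤ 1)
    (hX : ∀ a, (X a).PosSemidef) (hsum : (spec U lam - ∑ a, X a).PosSemidef)
    {θ : ℝ} (hθ : 0 < θ) {n : ℕ} (hn : Fintype.card ι ≤ n * θ) :
    n * ((∑ a, frobSq (X a)) - (1 - ∑ a, frobSq (X a)) / θ - 4 * θ)
      ≤ ∑ a, ∑ k : Fin n, frobSq (compressed U lam n k (X a)) := by
  have hs := sum_frobSq_compressed_sub_le hU h0 h1 hX hsum hθ hn
  have h2 : n * (∑ a, frobSq (X a)) - n * θ
      ≤ ∑ a, ∑ k : Fin n, frobSq (normalized U lam (X a) * thrProj U lam n k) := by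
    have h3 := Finset.sum_le_sum fun a (_ : a ∈ Finset.univ) =>
      le_sum_frobSq_mul_thr hU (sq_le_one_of_sum h1) n (normalized U lam (X a))
    refine le_trans ?_ h3
    rw [Finset.sum_sub_distrib, ← Finset.mul_sum]
    have h4 := sum_frobSq_normalized_mul_le hU h0 hX hsum 1
    rw [frobSq_one] at h4
    simp only [Matrix.mul_one] at h4
    have h5 : ∑ a, frobSq (X a) ≤ ∑ a, frobSq (normalized U lam (X a) * spec U lam) := by
      refine Finset.sum_le_sum fun a _ => ?_
      have h6 := frobSq_commutator hU h0 (hX a) (sub_posSemidef_of_sub_sum hX hsum a)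
      have h7 := frobSq_nonneg (spec U lam * normalized U lam (X a)
        - normalized U lam (X a) * spec U lam)
      linarith
    have h8 := mul_le_mul_of_nonneg_left h5 (n.cast_nonneg : (0 : ℝ) ≤ n)
    linarith
  have h9 : ∑ a, ∑ k : Fin n, frobSq (compressed U lam n k (X a))
      = ∑ a, ∑ k : Fin n, frobSq (normalized U lam (X a) * thrProj U lam n k)
        - ∑ a, ∑ k : Fin n, frobSq (compressed U lam n k (X a)
          - normalized U lam (X a) * thrProj U lam n k) := by
    simp only [← Finset.sum_sub_distrib]
    exact Finset.sum_congr rfl fun a _ => Finset.sum_congr rfl fun (k : Fin n) _ =>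
      frobSq_compressed hU lam n k (X a)
  rw [h9]
  linarith

theorem sum_frobSq_normalized_mul_thrProj_sub_le (hU : U ∈ unitaryGroup ι ℂ)
    (hV : V ∈ unitaryGroup ι ℂ) (hm0 : ∀ i, 0 ≤ mu i)
    (hl1 : ∑ i, lam i ^ 2 ≤ 1) (hm1 : ∑ i, mu i ^ 2 ≤ 1)
    (hY : ∀ a, (Y a).PosSemidef) (hYsum : (spec V mu - ∑ a, Y a).PosSemidef)
    {θ : ℝ} (hθ : 0 < θ) {n : ℕ} (hn : Fintype.card ι ≤ n * θ) :
    ∑ a, ∑ k : Fin n, frobSq (normalized V mu (Y a) * (thrProj U lam n k - thrProj V mu n k))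
      ≤ n * (frobSq (spec U lam - spec V mu) / (2 * θ) + 3 * θ) := by
  rw [Finset.sum_comm]
  refine (Finset.sum_le_sum fun (k : Fin n) _ =>
    sum_frobSq_normalized_mul_le hV hm0 hY hYsum _).trans ?_
  have h1 := sum_frobSq_thr_sub_le hU hV (sq_le_one_of_sum hl1) (sq_le_one_of_sum hm1) hθ n 1
  simp only [Matrix.mul_one, Matrix.one_mul, frobSq_one] at h1
  refine h1.trans ?_
  have h3 : frobSq (spec U lam - spec V mu) / (2 * θ)
      + θ * (frobSq (spec U lam) + frobSq (spec V mu))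
      ≤ frobSq (spec U lam - spec V mu) / (2 * θ) + 2 * θ := by
    rw [frobSq_spec hU, frobSq_spec hV]
    nlinarith
  have h4 := mul_le_mul_of_nonneg_left h3 (n.cast_nonneg : (0 : ℝ) ≤ n)
  linarith

theorem sum_frobSq_normalized_sub_mul_thrProj_le (hU : U ∈ unitaryGroup ι ℂ)
    (hV : V ∈ unitaryGroup ι ℂ) (hl0 : ∀ i, 0 ≤ lam i) (hm0 : ∀ i, 0 ≤ mu i)
    (hl1 : ∑ i, lam i ^ 2 ≤ 1) (hm1 : ∑ i, mu i ^ 2 ≤ 1)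
    (hX : ∀ a, (X a).PosSemidef) (hXsum : (spec U lam - ∑ a, X a).PosSemidef)
    (hY : ∀ a, (Y a).PosSemidef) (hYsum : (spec V mu - ∑ a, Y a).PosSemidef) (n : ℕ) :
    ∑ a, ∑ k : Fin n, frobSq ((normalized U lam (X a) - normalized V mu (Y a))
        * thrProj U lam n k)
      ≤ n * (4 * (2 * (1 - ∑ a, frobSq (X a)) + ∑ a, frobSq (X a - Y a)
        + 2 * (1 - ∑ a, frobSq (Y a)) + frobSq (spec U lam - spec V mu))) := by
  refine (Finset.sum_le_sum fun a _ =>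
    sum_frobSq_mul_thr_le hU (sq_le_one_of_sum hl1) n _).trans ?_
  rw [← Finset.mul_sum]
  refine mul_le_mul_of_nonneg_left ?_ n.cast_nonneg
  have h1 : ∀ a, frobSq ((normalized U lam (X a) - normalized V mu (Y a)) * spec U lam)
      ≤ 4 * (frobSq (normalized U lam (X a) * spec U lam - X a) + frobSq (X a - Y a)
        + frobSq (normalized V mu (Y a) * spec V mu - Y a)
        + frobSq (normalized V mu (Y a) * (spec V mu - spec U lam))) := by
    intro a
    rw [frobSq_sub_comm (_ * spec V mu)]
    refine le_trans (le_of_eq ?_) (frobSq_add_le _ _ _ _)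
    rw [Matrix.sub_mul, Matrix.mul_sub]
    congr 1
    abel
  refine (Finset.sum_le_sum fun a _ => h1 a).trans ?_
  rw [← Finset.mul_sum]
  simp only [Finset.sum_add_distrib]
  have h2 := sum_frobSq_normalized_mul_le hV hm0 hY hYsum (spec V mu - spec U lam)
  rw [frobSq_sub_comm (spec V mu)] at h2
  have h3 := (Finset.sum_le_sum fun a (_ : a ∈ Finset.univ) =>
    frobSq_normalized_mul_sub_le hU hl0 (hX a) (sub_posSemidef_of_sub_sum hX hXsum a)).trans
    (sum_frobSq_commutator_le hU hl0 hl1 hX hXsum)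
  have h4 := (Finset.sum_le_sum fun a (_ : a ∈ Finset.univ) =>
    frobSq_normalized_mul_sub_le hV hm0 (hY a) (sub_posSemidef_of_sub_sum hY hYsum a)).trans
    (sum_frobSq_commutator_le hV hm0 hm1 hY hYsum)
  linarith

theorem sum_frobSq_compressed_sub_compressed_le (hU : U ∈ unitaryGroup ι ℂ)
    (hV : V ∈ unitaryGroup ι ℂ) (hl0 : ∀ i, 0 ≤ lam i) (hm0 : ∀ i, 0 ≤ mu i)
    (hl1 : ∑ i, lam i ^ 2 ≤ 1) (hm1 : ∑ i, mu i ^ 2 ≤ 1)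
    (hX : ∀ a, (X a).PosSemidef) (hXsum : (spec U lam - ∑ a, X a).PosSemidef)
    (hY : ∀ a, (Y a).PosSemidef) (hYsum : (spec V mu - ∑ a, Y a).PosSemidef)
    {θ : ℝ} (hθ : 0 < θ) {n : ℕ} (hn : Fintype.card ι ≤ n * θ) :
    ∑ a, ∑ k : Fin n, frobSq (compressed U lam n k (X a) - compressed V mu n k (Y a))
      ≤ 4 * (n * ((1 - ∑ a, frobSq (X a)) / θ + 3 * θ)
        + n * (4 * (2 * (1 - ∑ a, frobSq (X a)) + ∑ a, frobSq (X a - Y a)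
          + 2 * (1 - ∑ a, frobSq (Y a)) + frobSq (spec U lam - spec V mu)))
        + n * (frobSq (spec U lam - spec V mu) / (2 * θ) + 3 * θ)
        + n * ((1 - ∑ a, frobSq (Y a)) / θ + 3 * θ)) := by
  have h1 : ∀ a (k : Fin n), frobSq (compressed U lam n k (X a) - compressed V mu n k (Y a))
      ≤ 4 * (frobSq (compressed U lam n k (X a) - normalized U lam (X a) * thrProj U lam n k)
        + frobSq ((normalized U lam (X a) - normalized V mu (Y a)) * thrProj U lam n k)
        + frobSq (normalized V mu (Y a) * (thrProj U lam n k - thrProj V mu n k))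
        + frobSq (compressed V mu n k (Y a) - normalized V mu (Y a) * thrProj V mu n k)) := by
    intro a k
    rw [frobSq_sub_comm (compressed V mu n k (Y a)) (normalized V mu (Y a) * _)]
    refine le_trans (le_of_eq ?_) (frobSq_add_le _ _ _ _)
    generalize compressed U lam n k (X a) = P
    generalize compressed V mu n k (Y a) = P'
    rw [Matrix.sub_mul, Matrix.mul_sub]
    congr 1
    abel
  refine (Finset.sum_le_sum fun a _ => Finset.sum_le_sum fun k _ => h1 a k).trans ?_
  simp only [← Finset.mul_sum, Finset.sum_add_distrib]
  refine mul_le_mul_of_nonneg_left (add_le_add (add_le_add (add_le_add ?_ ?_) ?_) ?_) (by norm_num)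
  · exact sum_frobSq_compressed_sub_le hU hl0 hl1 hX hXsum hθ hn
  · exact sum_frobSq_normalized_sub_mul_thrProj_le hU hV hl0 hm0 hl1 hm1 hX hXsum hY hYsum n
  · exact sum_frobSq_normalized_mul_thrProj_sub_le hU hV hm0 hl1 hm1 hY hYsum hθ hn
  · exact sum_frobSq_compressed_sub_le hV hm0 hm1 hY hYsum hθ hn

theorem sum_reTr_compressed_eq (hU : U ∈ unitaryGroup ι ℂ) (hV : V ∈ unitaryGroup ι ℂ)
    (hX : ∀ a, (X a).PosSemidef) (hY : ∀ a, (Y a).PosSemidef) (n : ℕ) :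
    2 * ∑ a, ∑ k : Fin n, reTr (compressed U lam n k (X a)) (compressed V mu n k (Y a))
      = ∑ a, ∑ k : Fin n, frobSq (compressed U lam n k (X a))
        + ∑ a, ∑ k : Fin n, frobSq (compressed V mu n k (Y a))
        - ∑ a, ∑ k : Fin n, frobSq (compressed U lam n k (X a) - compressed V mu n k (Y a)) := by
  simp only [Finset.mul_sum, ← Finset.sum_add_distrib, ← Finset.sum_sub_distrib]
  refine Finset.sum_congr rfl fun a _ => Finset.sum_congr rfl fun k _ => ?_
  rw [frobSq_sub (compressed_posSemidef hU lam n k (hX a)).1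
    (compressed_posSemidef hV mu n k (hY a)).1]
  ring

/-- Quantum correlated sampling, pairwise form. -/
theorem le_sum_reTr_compressed (hU : U ∈ unitaryGroup ι ℂ) (hV : V ∈ unitaryGroup ι ℂ)
    (hl0 : ∀ i, 0 ≤ lam i) (hm0 : ∀ i, 0 ≤ mu i)
    (hl1 : ∑ i, lam i ^ 2 ≤ 1) (hm1 : ∑ i, mu i ^ 2 ≤ 1)
    (hX : ∀ a, (X a).PosSemidef) (hXsum : (spec U lam - ∑ a, X a).PosSemidef)
    (hY : ∀ a, (Y a).PosSemidef) (hYsum : (spec V mu - ∑ a, Y a).PosSemidef)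
    {θ : ℝ} (hθ : 0 < θ) (hθ1 : θ ≤ 1) {n : ℕ} (hn : Fintype.card ι ≤ n * θ) :
    n * (1 - 28 * ((1 - ∑ a, frobSq (X a)) + (1 - ∑ a, frobSq (Y a))
        + ∑ a, frobSq (X a - Y a)) / θ - 22 * θ)
      ≤ ∑ a, ∑ k : Fin n, reTr (compressed U lam n k (X a)) (compressed V mu n k (Y a)) := by
  have hA := le_sum_frobSq_compressed hU hl0 hl1 hX hXsum hθ hn
  have hB := le_sum_frobSq_compressed hV hm0 hm1 hY hYsum hθ hn
  have hC := sum_frobSq_compressed_sub_compressed_le hU hV hl0 hm0 hl1 hm1 hX hXsum hY hYsum hθ hn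
  have hpol := sum_reTr_compressed_eq hU hV (lam := lam) (mu := mu) hX hY n
  have hD0 : 0 ≤ ∑ a, frobSq (X a - Y a) := Finset.sum_nonneg fun a _ => frobSq_nonneg _
  have hXX := sum_reTr_le hX hX hXsum hXsum
  have hYY := sum_reTr_le hY hY hYsum hYsum
  have hXY := sum_reTr_le hX hY hXsum hYsum
  simp only [← frobSq_eq_reTr (hX _).1, ← frobSq_eq_reTr (spec_isHermitian lam)] at hXX
  simp only [← frobSq_eq_reTr (hY _).1, ← frobSq_eq_reTr (spec_isHermitian mu)] at hYY
  have hL : frobSq (spec U lam) ≤ 1 := by rwa [frobSq_spec hU]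
  have hL' : frobSq (spec V mu) ≤ 1 := by rwa [frobSq_spec hV]
  have hDeq : ∑ a, frobSq (X a - Y a)
      = ∑ a, frobSq (X a) + ∑ a, frobSq (Y a) - 2 * ∑ a, reTr (X a) (Y a) := by
    rw [Finset.sum_congr rfl fun a _ => frobSq_sub (hX a).1 (hY a).1,
      Finset.sum_sub_distrib, Finset.sum_add_distrib, ← Finset.mul_sum]
  have hF := frobSq_sub (spec_isHermitian (U := U) lam) (spec_isHermitian (U := V) mu)
  have hn0 : (0 : ℝ) ≤ n := n.cast_nonneg
  generalize ∑ a, ∑ k : Fin n, reTr (compressed U lam n k (X a)) (compressed V mu n k (Y a))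
    = T at *
  generalize ∑ a, ∑ k : Fin n, frobSq (compressed U lam n k (X a)) = T₁ at *
  generalize ∑ a, ∑ k : Fin n, frobSq (compressed V mu n k (Y a)) = T₂ at *
  generalize ∑ a, ∑ k : Fin n, frobSq (compressed U lam n k (X a) - compressed V mu n k (Y a))
    = T₃ at *
  generalize ∑ a, frobSq (X a - Y a) = D at *
  generalize ∑ a, reTr (X a) (Y a) = R at *
  generalize hF' : frobSq (spec U lam - spec V mu) = F at *
  obtain ⟨e, he⟩ : ∃ e, ∑ a, frobSq (X a) = 1 - e := ⟨1 - ∑ a, frobSq (X a), by ring⟩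
  obtain ⟨e', he'⟩ : ∃ e, ∑ a, frobSq (Y a) = 1 - e := ⟨1 - ∑ a, frobSq (Y a), by ring⟩
  simp only [he, he', sub_sub_cancel] at *
  have he0 : 0 ≤ e := by linarith
  have he0' : 0 ≤ e' := by linarith
  have hFD : F ≤ e + e' + D := by linarith
  have key : ∀ x : ℝ, 0 ≤ x → x ≤ x / θ := fun x hx => by
    rw [le_div_iff₀ hθ]; exact mul_le_of_le_one_right hx hθ1
  have h1 := key e he0
  have h2 := key e' he0'
  have h3 := key D hD0
  have h4 : F / (2 * θ) ≤ (e / θ + e' / θ + D / θ) / 2 := by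
    rw [← add_div, ← add_div, div_div, mul_comm θ]
    gcongr
  have h5 : 28 * (e + e' + D) / θ = 28 * (e / θ + e' / θ + D / θ) := by field_simp
  rw [h5]
  have h6 : 0 ≤ D / θ := by positivity
  have h7 : 1 - 28 * (e / θ + e' / θ + D / θ) - 22 * θ ≤ ((1 - e - e / θ - 4 * θ)
      + (1 - e' - e' / θ - 4 * θ) - 4 * ((e / θ + 3 * θ) + 4 * (2 * e + D + 2 * e' + F)
      + (F / (2 * θ) + 3 * θ) + (e' / θ + 3 * θ))) / 2 := by linarith
  have h8 := mul_le_mul_of_nonneg_left h7 hn0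
  linarith

end Sampling

section Trace

variable {ι κ : Type*} [Fintype ι] [Fintype κ]

theorem trace_mul_im_eq_zero {X Y : Matrix ι ι ℂ} (hX : X.IsHermitian) (hY : Y.IsHermitian) :
    (trace (X * Y)).im = 0 := by
  have h : star (trace (X * Y)) = trace (X * Y) := by
    rw [← trace_conjTranspose, conjTranspose_mul, hX.eq, hY.eq, trace_mul_comm]
  exact Complex.conj_eq_iff_im.mp h

theorem reTr_kronecker {X Z : Matrix ι ι ℂ} (Y W : Matrix κ κ ℂ) (hX : X.IsHermitian)
    (hZ : Z.IsHermitian) : reTr (X ⊗ₖ Y) (Z ⊗ₖ W) = reTr X Z * reTr Y W := by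
  rw [reTr, ← mul_kronecker_mul, trace_kronecker, Complex.mul_re, trace_mul_im_eq_zero hX hZ,
    zero_mul, sub_zero]
  rfl

end Trace

namespace ProjGame

variable (G : ProjGame)

/-- The sum of the operators `F v b` over the answers `b` projecting to `a`. -/
def crs {ι : Type*} (F : G.V → G.B → Matrix ι ι ℂ) (u : G.U) (v : G.V) (a : G.A) :
    Matrix ι ι ℂ :=
  ∑ b, if G.proj u v b = some a then F v b else 0

section crs

variable {G} {ι : Type*} {F : G.V → G.B → Matrix ι ι ℂ}

theorem crs_posSemidef [Fintype ι] (hF : ∀ v b, (F v b).PosSemidef) (u : G.U) (v : G.V)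
    (a : G.A) : (G.crs F u v a).PosSemidef :=
  PosSemidef.sum_univ fun b => (hF v b).ite_zero _

theorem sum_sub_sum_crs_posSemidef [Fintype ι] (hF : ∀ v b, (F v b).PosSemidef) (u : G.U)
    (v : G.V) : (∑ b, F v b - ∑ a, G.crs F u v a).PosSemidef := by
  have h : ∑ b, F v b - ∑ a, G.crs F u v a
      = ∑ b, if G.proj u v b = none then F v b else 0 := by
    simp only [crs]
    rw [Finset.sum_comm, ← Finset.sum_sub_distrib]
    refine Finset.sum_congr rfl fun b _ => ?_
    rcases hb : G.proj u v b with _ | a₀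
    · simp
    · simp
  rw [h]
  exact PosSemidef.sum_univ fun b => (hF v b).ite_zero _

theorem sum_reTr_crs_le [Fintype ι] [DecidableEq ι] (hF : ∀ v b, (F v b).PosSemidef) (u : G.U)
    (v v' : G.V) :
    ∑ a, reTr (G.crs F u v a) (G.crs F u v' a) ≤ reTr (∑ b, F v b) (∑ b, F v' b) :=
  sum_reTr_le (fun a => crs_posSemidef hF u v a) (fun a => crs_posSemidef hF u v' a)
    (sum_sub_sum_crs_posSemidef hF u v) (sum_sub_sum_crs_posSemidef hF u v')

end crs

/-- One round of rejection sampling: measure with `N`, and on failure fall back to `B`. -/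
def fallback {J I : Type*} [Fintype J] [DecidableEq J] [DecidableEq I]
    (N : G.V → G.B → Matrix J J ℂ) (B : G.V → G.B → Matrix I I ℂ) (v : G.V) (b : G.B) :
    Matrix (J × I) (J × I) ℂ :=
  N v b ⊗ₖ (1 : Matrix I I ℂ) + (1 - ∑ b', N v b') ⊗ₖ B v b

section fallback

variable {G} {J I : Type*} [Fintype J] [DecidableEq J] [DecidableEq I]
  {N : G.V → G.B → Matrix J J ℂ} {B : G.V → G.B → Matrix I I ℂ}

theorem fallback_posSemidef [Fintype I] (hN : ∀ v b, (N v b).PosSemidef)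
    (hN1 : ∀ v, (1 - ∑ b, N v b).PosSemidef) (hB : ∀ v b, (B v b).PosSemidef) (v : G.V)
    (b : G.B) : (G.fallback N B v b).PosSemidef :=
  ((hN v b).kronecker PosSemidef.one).add ((hN1 v).kronecker (hB v b))

theorem sum_kronecker {β m n : Type*} (s : Finset β) (X : β → Matrix m m ℂ)
    (Y : Matrix n n ℂ) : (∑ b ∈ s, X b) ⊗ₖ Y = ∑ b ∈ s, X b ⊗ₖ Y := by
  ext i j
  simp [kroneckerMap_apply, Matrix.sum_apply, Finset.sum_mul]

theorem kronecker_sum {β m n : Type*} (s : Finset β) (X : Matrix m m ℂ)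
    (Y : β → Matrix n n ℂ) : X ⊗ₖ (∑ b ∈ s, Y b) = ∑ b ∈ s, X ⊗ₖ Y b := by
  ext i j
  simp [kroneckerMap_apply, Matrix.sum_apply, Finset.mul_sum]

theorem sum_fallback (hB : ∀ v, ∑ b, B v b = 1) (v : G.V) : ∑ b, G.fallback N B v b = 1 := by
  simp only [fallback]
  rw [Finset.sum_add_distrib, ← sum_kronecker, ← kronecker_sum, hB, ← add_kronecker,
    add_sub_cancel, one_kronecker_one]

theorem crs_fallback (u : G.U) (v : G.V) (a : G.A) :
    G.crs (G.fallback N B) u v a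
      = G.crs N u v a ⊗ₖ (1 : Matrix I I ℂ) + (1 - ∑ b, N v b) ⊗ₖ G.crs B u v a := by
  simp only [crs]
  rw [sum_kronecker, kronecker_sum, ← Finset.sum_add_distrib]
  refine Finset.sum_congr rfl fun b _ => ?_
  split_ifs <;> simp [fallback]

theorem le_sum_reTr_crs_fallback [Fintype I] (hN : ∀ v b, (N v b).PosSemidef)
    (hN1 : ∀ v, (1 - ∑ b, N v b).PosSemidef) (hB : ∀ v b, (B v b).PosSemidef) (u : G.U)
    (v v' : G.V) :
    (∑ a, reTr (G.crs N u v a) (G.crs N u v' a)) * Fintype.card I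
        + reTr (1 - ∑ b, N v b) (1 - ∑ b, N v' b) * ∑ a, reTr (G.crs B u v a) (G.crs B u v' a)
      ≤ ∑ a, reTr (G.crs (G.fallback N B) u v a) (G.crs (G.fallback N B) u v' a) := by
  rw [Finset.sum_mul, Finset.mul_sum, ← Finset.sum_add_distrib]
  refine Finset.sum_le_sum fun a _ => ?_
  have hc := fun w => crs_posSemidef hN u w a
  have hd := fun w => crs_posSemidef hB u w a
  have h1 := reTr_kronecker (1 : Matrix I I ℂ) 1 (hc v).1 (hc v').1
  have h2 := reTr_kronecker (G.crs B u v a) (G.crs B u v' a) (hN1 v).1 (hN1 v').1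
  have h3 := reTr_nonneg ((hc v).kronecker (PosSemidef.one (n := I))) ((hN1 v').kronecker (hd v'))
  have h4 := reTr_nonneg ((hN1 v).kronecker (hd v)) ((hc v').kronecker (PosSemidef.one (n := I)))
  have h5 : reTr (1 : Matrix I I ℂ) 1 = Fintype.card I := by simp [reTr]
  rw [h5] at h1
  simp only [crs_fallback, reTr_add_left, reTr_add_right]
  linarith

end fallback

/-- Iterated rejection sampling completes a sub-POVM of small trace to a POVM. -/
theorem exists_povm_of_subPOVM {G : ProjGame} {J : Type} [Fintype J] [DecidableEq J] [Nonempty J]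
    {N : G.V → G.B → Matrix J J ℂ} (hN : ∀ v b, (N v b).PosSemidef)
    (hN1 : ∀ v, (1 - ∑ b, N v b).PosSemidef) {ρ : ℝ} (hρ : 0 < ρ) (hρ1 : ρ ≤ 1)
    (htr : ∀ v, (trace (∑ b, N v b)).re ≤ ρ * Fintype.card J) (b₀ : G.B) (t : ℕ) :
    ∃ (I : Type) (_ : Fintype I) (_ : DecidableEq I) (_ : Nonempty I)
      (B : G.V → G.B → Matrix I I ℂ),
      (∀ v b, (B v b).PosSemidef) ∧ (∀ v, ∑ b, B v b = 1) ∧ ∀ u v v',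
        2 * ((∑ a, reTr (G.crs N u v a) (G.crs N u v' a)) / (ρ * Fintype.card J)) - 1 - (1 - ρ) ^ t
          ≤ (∑ a, reTr (G.crs B u v a) (G.crs B u v' a)) / Fintype.card I := by
  classical
  have hJ : (0 : ℝ) < Fintype.card J := by exact_mod_cast Fintype.card_pos
  have hle : ∀ u v v', ∑ a, reTr (G.crs N u v a) (G.crs N u v' a) ≤ ρ * Fintype.card J := by
    intro u v v'
    refine (sum_reTr_crs_le hN u v v').trans (le_trans ?_ (htr v))
    have h := reTr_nonneg (PosSemidef.sum_univ (hN v)) (hN1 v')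
    rw [reTr_sub_right] at h
    have h1 : reTr (∑ b, N v b) 1 = (trace (∑ b, N v b)).re := by rw [reTr, Matrix.mul_one]
    linarith
  induction t with
  | zero =>
    refine ⟨Unit, inferInstance, inferInstance, inferInstance, fun _ b => if b = b₀ then 1 else 0,
      fun v b => PosSemidef.one.ite_zero _, fun v => by simp, fun u v v' => ?_⟩
    refine le_trans (b := 0) ?_ (div_nonneg (Finset.sum_nonneg fun a _ => reTr_nonneg
      (crs_posSemidef (fun v b => PosSemidef.one.ite_zero _) u v a)
      (crs_posSemidef (fun v b => PosSemidef.one.ite_zero _) u v' a)) (Nat.cast_nonneg _))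
    have h := (div_le_one (by positivity)).mpr (hle u v v')
    rw [pow_zero]
    linarith
  | succ t ih =>
    obtain ⟨I, _, _, _, B, hB, hB1, hx⟩ := ih
    refine ⟨J × I, inferInstance, inferInstance, inferInstance, G.fallback N B,
      fallback_posSemidef hN hN1 hB, sum_fallback hB1, fun u v v' => ?_⟩
    have hI : (0 : ℝ) < Fintype.card I := by exact_mod_cast Fintype.card_pos
    have hstep := le_sum_reTr_crs_fallback hN hN1 hB u v v'
    have hx' := hx u v v'
    have hxnn : 0 ≤ (∑ a, reTr (G.crs B u v a) (G.crs B u v' a)) / Fintype.card I :=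
      div_nonneg (Finset.sum_nonneg fun a _ => reTr_nonneg (crs_posSemidef hB u v a)
        (crs_posSemidef hB u v' a)) hI.le
    have hSnn : 0 ≤ ∑ a, reTr (G.crs N u v a) (G.crs N u v' a) :=
      Finset.sum_nonneg fun a _ => reTr_nonneg (crs_posSemidef hN u v a) (crs_posSemidef hN u v' a)
    have hq0 := reTr_nonneg (hN1 v) (hN1 v')
    have hq : Fintype.card J - 2 * (ρ * Fintype.card J)
        + ∑ a, reTr (G.crs N u v a) (G.crs N u v' a)
        ≤ reTr (1 - ∑ b, N v b) (1 - ∑ b, N v' b) := by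
      have h1 := sum_reTr_crs_le hN u v v'
      have h2 := htr v
      have h3 := htr v'
      have h4 : reTr (1 - ∑ b, N v b) (1 - ∑ b, N v' b) = Fintype.card J
          - (trace (∑ b, N v b)).re - (trace (∑ b, N v' b)).re
          + reTr (∑ b, N v b) (∑ b, N v' b) := by
        rw [reTr_sub_left, reTr_sub_right, reTr_sub_right]
        simp only [reTr, Matrix.one_mul, Matrix.mul_one, trace_one]
        simp only [Complex.natCast_re]
        ring
      linarith
    have hS := hle u v v'
    rw [Fintype.card_prod, Nat.cast_mul, le_div_iff₀ (mul_pos hJ hI)]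
    refine le_trans ?_ hstep
    generalize ∑ a, reTr (G.crs N u v a) (G.crs N u v' a) = S at *
    generalize reTr (1 - ∑ b, N v b) (1 - ∑ b, N v' b) = Q at *
    generalize (Fintype.card J : ℝ) = j at *
    generalize (Fintype.card I : ℝ) = i at *
    obtain ⟨x, hxe⟩ : ∃ x, x = (∑ a, reTr (G.crs B u v a) (G.crs B u v' a)) / i := ⟨_, rfl⟩
    have hxe' : ∑ a, reTr (G.crs B u v a) (G.crs B u v' a) = x * i := by
      rw [hxe]; field_simp
    rw [← hxe] at hx' hxnn
    rw [hxe']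
    obtain ⟨s, hs⟩ : ∃ s, s = S / (ρ * j) := ⟨_, rfl⟩
    obtain ⟨q, hqe⟩ : ∃ q, q = Q / j := ⟨_, rfl⟩
    have hS' : S = s * (ρ * j) := by rw [hs]; field_simp
    have hQ' : Q = q * j := by rw [hqe]; field_simp
    rw [← hs] at hx' ⊢
    rw [hS'] at hq hS hSnn ⊢
    rw [hQ'] at hq hq0 ⊢
    have hs1 : s ≤ 1 := le_of_mul_le_mul_right (by linarith) (mul_pos hρ hJ)
    have hs0 : 0 ≤ s := nonneg_of_mul_nonneg_left hSnn (mul_pos hρ hJ)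
    have hqn : 0 ≤ q := nonneg_of_mul_nonneg_left hq0 hJ
    have hq1 : 1 - 2 * ρ + s * ρ ≤ q := le_of_mul_le_mul_right (by linarith) hJ
    have hr : 0 ≤ (1 - ρ) ^ t := pow_nonneg (by linarith) t
    have main : 2 * s - 1 - (1 - ρ) ^ (t + 1) ≤ s * ρ + q * x := by
      rw [pow_succ]
      generalize (1 - ρ) ^ t = r at *
      rcases le_or_gt 0 (2 * s - 1 - r) with h | h
      · have h1 : (1 - 2 * ρ + s * ρ) * (2 * s - 1 - r) ≤ q * x :=
          (mul_le_mul_of_nonneg_right hq1 h).trans (mul_le_mul_of_nonneg_left hx' hqn)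
        have h2 : 0 ≤ ρ * (1 - s) * (1 - (2 * s - 1 - r)) :=
          mul_nonneg (mul_nonneg hρ.le (by linarith)) (by linarith)
        nlinarith
      · have h1 : 0 ≤ q * x := mul_nonneg hqn hxnn
        have h2 : (1 - ρ) * (2 * s - 1 - r) ≤ 0 := mul_nonpos_of_nonneg_of_nonpos
          (by linarith) h.le
        nlinarith
    have := mul_le_mul_of_nonneg_right main (mul_pos hJ hI).le
    linarith

end ProjGame

section Braket

variable {ι κ : Type*} [Fintype ι] [Fintype κ]

theorem braket_sum {β : Type*} (s : Finset β) (ψ : ι → ℂ) (M : β → Matrix ι ι ℂ) :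
    braket ψ (∑ b ∈ s, M b) = ∑ b ∈ s, braket ψ (M b) := by
  simp only [braket, Matrix.sum_mulVec, dotProduct_sum]

theorem braket_smul (ψ : ι → ℂ) (c : ℂ) (M : Matrix ι ι ℂ) :
    braket ψ (c • M) = c * braket ψ M := by
  simp only [braket, smul_mulVec, dotProduct_smul, smul_eq_mul]

theorem braket_kronecker {A : Matrix ι ι ℂ} (hA : A.IsHermitian) (C : Matrix κ κ ℂ)
    (Y : Matrix κ ι ℂ) :
    braket (fun p : ι × κ => Y p.2 p.1) (mconj A ⊗ₖ C) = trace (C * Y * A * Yᴴ) := by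
  have hA' : ∀ k k', (starRingEnd ℂ) (A k k') = A k' k := fun k k' => hA.apply k' k
  simp only [braket, dotProduct, mulVec, trace, diag_apply, mul_apply, Fintype.sum_prod_type,
    kroneckerMap_apply, mconj, map_apply, hA', Pi.star_apply, conjTranspose_apply,
    Finset.sum_mul, Finset.mul_sum]
  rw [Finset.sum_comm]
  refine Finset.sum_congr rfl fun l _ => Finset.sum_congr rfl fun k _ =>
    Finset.sum_congr rfl fun k' _ => Finset.sum_congr rfl fun l' _ => by ring

theorem enormSq_prod (Y : Matrix κ ι ℂ) :
    enormSq (fun p : ι × κ => Y p.2 p.1) = ∑ l, ∑ k, ‖Y l k‖ ^ 2 := by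
  simp only [enormSq, Fintype.sum_prod_type, Complex.normSq_eq_norm_sq]
  exact Finset.sum_comm

theorem enormSq_eq_norm_sq (ψ : ι → ℂ) : enormSq ψ = ‖WithLp.toLp 2 ψ‖ ^ 2 := by
  rw [EuclideanSpace.norm_sq_eq]
  simp only [enormSq, Complex.normSq_eq_norm_sq]

theorem braket_eq_inner [DecidableEq ι] (ψ : ι → ℂ) (M : Matrix ι ι ℂ) :
    braket ψ M = inner ℂ (WithLp.toLp 2 ψ) (toEuclideanCLM (𝕜 := ℂ) M (WithLp.toLp 2 ψ)) := by
  rw [EuclideanSpace.inner_eq_star_dotProduct, ofLp_toEuclideanCLM, dotProduct_comm]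
  rfl

theorem re_braket_le [DecidableEq ι] (ψ : ι → ℂ) (M : Matrix ι ι ℂ) :
    (braket ψ M).re ≤ opNorm M * enormSq ψ := by
  rw [braket_eq_inner, enormSq_eq_norm_sq]
  refine (Complex.re_le_norm _).trans ((norm_inner_le_norm _ _).trans ?_)
  have h := (toEuclideanCLM (𝕜 := ℂ) M).le_opNorm (WithLp.toLp 2 ψ)
  rw [opNorm]
  nlinarith [norm_nonneg (WithLp.toLp 2 ψ)]

theorem opNorm_nonneg [DecidableEq ι] (M : Matrix ι ι ℂ) : 0 ≤ opNorm M := norm_nonneg _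

theorem opNorm_one_le [DecidableEq ι] : opNorm (1 : Matrix ι ι ℂ) ≤ 1 := by
  rw [opNorm, map_one]
  exact ContinuousLinearMap.norm_id_le

theorem exists_lt_braket [DecidableEq ι] {M : Matrix ι ι ℂ} (hM : M.PosSemidef) {c : ℝ}
    (hc : 0 ≤ c) (h : c < opNorm M) : ∃ ψ, c * enormSq ψ < (braket ψ M).re := by
  by_contra! hcon
  obtain ⟨B, rfl⟩ := hM.exists_eq_conjTranspose_mul_self
  refine h.not_ge ?_
  have h1 : toEuclideanCLM (𝕜 := ℂ) (Bᴴ * B)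
      = star (toEuclideanCLM (𝕜 := ℂ) B) * toEuclideanCLM (𝕜 := ℂ) B := by
    rw [map_mul, ← star_eq_conjTranspose, map_star]
  rw [opNorm, h1, ContinuousLinearMap.star_eq_adjoint, ContinuousLinearMap.mul_def,
    ContinuousLinearMap.norm_adjoint_comp_self, ← pow_two]
  refine (Real.le_sqrt (norm_nonneg _) hc).mp ?_
  refine ContinuousLinearMap.opNorm_le_bound _ (Real.sqrt_nonneg _) fun x => ?_
  have h2 := hcon x.ofLp
  rw [braket_eq_inner, enormSq_eq_norm_sq, h1] at h2
  simp only [WithLp.toLp_ofLp] at h2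
  rw [mul_apply_eq_comp, ContinuousLinearMap.star_eq_adjoint,
    ContinuousLinearMap.adjoint_inner_right, inner_self_eq_norm_sq_to_K] at h2
  refine le_of_sq_le_sq ?_ (by positivity)
  rw [mul_pow, Real.sq_sqrt hc]
  refine le_trans (le_of_eq ?_) h2
  norm_cast

end Braket

section mconj

variable {ι : Type*}

theorem mconj_sum {β : Type*} (s : Finset β) (M : β → Matrix ι ι ℂ) :
    mconj (∑ b ∈ s, M b) = ∑ b ∈ s, mconj (M b) := by
  ext i j
  simp [mconj, Matrix.sum_apply]

theorem mconj_real_smul (c : ℝ) (M : Matrix ι ι ℂ) : mconj ((c : ℂ) • M) = (c : ℂ) • mconj M := by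
  ext i j
  simp [mconj]

theorem mconj_posSemidef {M : Matrix ι ι ℂ} (hM : M.PosSemidef) : (mconj M).PosSemidef := by
  have h : mconj M = Mᵀ := by
    ext i j
    exact hM.1.apply j i
  rw [h]
  exact hM.transpose

end mconj

namespace ProjGame

variable {G : ProjGame} {n d : ℕ}

theorem μL_nonneg (u : G.U) : 0 ≤ G.μL u := Finset.sum_nonneg fun v _ => G.μ_nonneg u v

theorem μc_nonneg (u : G.U) (v : G.V) : 0 ≤ G.μc u v := div_nonneg (G.μ_nonneg u v) (μL_nonneg u)

theorem Bop_eq_sum_crs (B : G.V → G.B → Mat d) (u : G.U) (a : G.A) :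
    G.Bop B u a = ∑ v, (G.μc u v : ℂ) • G.crs B u v a := by
  simp only [Bop, crs, Finset.smul_sum, smul_ite, smul_zero]

theorem mconj_Bop_kronecker_Bop (B : G.V → G.B → Mat d) (u : G.U) (a : G.A) :
    mconj (G.Bop B u a) ⊗ₖ G.Bop B u a
      = ∑ v, ∑ v', ((G.μc u v * G.μc u v' : ℝ) : ℂ) •
        (mconj (G.crs B u v a) ⊗ₖ G.crs B u v' a) := by
  rw [Bop_eq_sum_crs, mconj_sum, sum_kronecker]
  refine Finset.sum_congr rfl fun v _ => ?_
  rw [kronecker_sum]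
  refine Finset.sum_congr rfl fun v' _ => ?_
  rw [mconj_real_smul, smul_kronecker, kronecker_smul, smul_smul, Complex.ofReal_mul]

theorem mconj_crs_kronecker_crs (B : G.V → G.B → Mat d) (u : G.U) (v v' : G.V) (a : G.A) :
    mconj (G.crs B u v a) ⊗ₖ G.crs B u v' a
      = ∑ b, ∑ b', if G.proj u v b = some a ∧ G.proj u v' b' = some a then
        mconj (B v b) ⊗ₖ B v' b' else 0 := by
  rw [crs, mconj_sum, sum_kronecker]
  refine Finset.sum_congr rfl fun b _ => ?_
  rw [crs, kronecker_sum]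
  refine Finset.sum_congr rfl fun b' _ => ?_
  have h0 : mconj (0 : Mat d) = 0 := by ext; simp [mconj]
  by_cases h : G.proj u v b = some a <;> by_cases h' : G.proj u v' b' = some a <;>
    simp [h, h', h0]

theorem vecMat_eq (w : Fin n → ℝ) (A : Fin n → G.V → G.B → Mat d) :
    G.vecMat w A = ∑ i, (w i : ℂ) • G.sqMat (A i) := by
  simp only [vecMat, sqMat, mconj_Bop_kronecker_Bop, mconj_crs_kronecker_crs]

theorem Bop_posSemidef {B : G.V → G.B → Mat d} (hB : ∀ v b, (B v b).PosSemidef) (u : G.U)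
    (a : G.A) : (G.Bop B u a).PosSemidef := by
  rw [Bop_eq_sum_crs]
  exact PosSemidef.sum_univ fun v => (crs_posSemidef hB u v a).smul_real (μc_nonneg u v)

theorem sqMat_posSemidef {B : G.V → G.B → Mat d} (hB : ∀ v b, (B v b).PosSemidef) :
    (G.sqMat B).PosSemidef :=
  PosSemidef.sum_univ fun u => (PosSemidef.sum_univ fun a =>
    (mconj_posSemidef (Bop_posSemidef hB u a)).kronecker (Bop_posSemidef hB u a)).smul_real
      (μL_nonneg u)

theorem vecMat_posSemidef {w : Fin n → ℝ} (hw : ∀ i, 0 ≤ w i) {A : Fin n → G.V → G.B → Mat d}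
    (hA : ∀ i v b, (A i v b).PosSemidef) : (G.vecMat w A).PosSemidef := by
  rw [vecMat_eq]
  exact PosSemidef.sum_univ fun i => (sqMat_posSemidef (hA i)).smul_real (hw i)

/-- The joint probability of the questions `u`, `v`, `v'`. -/
def μ₃ (G : ProjGame) (u : G.U) (v v' : G.V) : ℝ := G.μL u * (G.μc u v * G.μc u v')

theorem μ₃_nonneg (u : G.U) (v v' : G.V) : 0 ≤ G.μ₃ u v v' :=
  mul_nonneg (μL_nonneg u) (mul_nonneg (μc_nonneg u v) (μc_nonneg u v'))

theorem sum_μ₃ : ∑ u, ∑ v, ∑ v', G.μ₃ u v v' = 1 := by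
  rw [← G.μ_sum]
  refine Finset.sum_congr rfl fun u _ => ?_
  simp only [μ₃, ← Finset.mul_sum, ← Finset.sum_mul]
  change _ = G.μL u
  rcases eq_or_ne (G.μL u) 0 with h | h
  · rw [h, zero_mul]
  · have h1 : ∑ v, G.μc u v = 1 := by
      simp only [μc, ← Finset.sum_div]
      exact div_self h
    rw [h1, mul_one, mul_one]

theorem braket_sqMat {B : G.V → G.B → Mat d} (hB : ∀ v b, (B v b).PosSemidef) (Y : Mat d) :
    braket (fun p : Fin d × Fin d => Y p.2 p.1) (G.sqMat B)
      = ∑ u, (G.μL u : ℂ) * ∑ a, trace (G.Bop B u a * Y * G.Bop B u a * Yᴴ) := by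
  simp only [sqMat, braket_sum, braket_smul, braket_kronecker (Bop_posSemidef hB _ _).1]

end ProjGame

section blockDiagonal

variable {ι o : Type*} [Fintype ι] [Fintype o] [DecidableEq o]

theorem reTr_blockDiagonal (X Y : o → Matrix ι ι ℂ) :
    reTr (blockDiagonal X) (blockDiagonal Y) = ∑ k, reTr (X k) (Y k) := by
  rw [reTr, ← blockDiagonal_mul, trace_blockDiagonal, Complex.re_sum]
  rfl

theorem blockDiagonal_posSemidef [DecidableEq ι] {X : o → Matrix ι ι ℂ}
    (hX : ∀ k, (X k).PosSemidef) : (blockDiagonal X).PosSemidef := by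
  choose B hB using fun k => (hX k).exists_eq_conjTranspose_mul_self
  rw [funext hB, blockDiagonal_mul, ← blockDiagonal_conjTranspose]
  exact posSemidef_conjTranspose_mul_self _

end blockDiagonal

theorem blockDiagonal_sum {ι o β : Type*} [DecidableEq o] (s : Finset β)
    (X : β → o → Matrix ι ι ℂ) :
    blockDiagonal (fun k => ∑ b ∈ s, X b k) = ∑ b ∈ s, blockDiagonal (X b) := by
  rw [← Finset.sum_fn]
  exact map_sum (blockDiagonalAddMonoidHom ι ι o ℂ) X s

section Hermitian

variable {ι : Type*} [Fintype ι]

theorem re_trace_cartesian {A H K : Matrix ι ι ℂ} (hH : H.IsHermitian)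
    (hK : K.IsHermitian) :
    (trace (A * (H + Complex.I • K) * A * (H + Complex.I • K)ᴴ)).re
      = reTr (A * H * A) H + reTr (A * K * A) K := by
  have h1 : trace (A * K * A * H) = trace (A * H * A * K) := by
    rw [Matrix.mul_assoc (A * K), trace_mul_comm, Matrix.mul_assoc (A * H), Matrix.mul_assoc]
  rw [conjTranspose_add, conjTranspose_smul, hH.eq, hK.eq]
  simp only [Matrix.mul_add, Matrix.add_mul, Matrix.mul_smul, Matrix.smul_mul, trace_add,
    trace_smul, smul_eq_mul, reTr, h1]
  simp

theorem frobSq_cartesian {H K : Matrix ι ι ℂ} (hH : H.IsHermitian) (hK : K.IsHermitian) :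
    frobSq (H + Complex.I • K) = frobSq H + frobSq K := by
  classical
  have h := re_trace_cartesian (A := 1) hH hK
  simp only [Matrix.one_mul, Matrix.mul_one] at h
  rw [frobSq_eq_reTr_conjTranspose, reTr_comm, frobSq_eq_reTr hH, frobSq_eq_reTr hK, ← h]
  rfl

theorem exists_cartesian {ι : Type*} (Y : Matrix ι ι ℂ) :
    ∃ H K : Matrix ι ι ℂ, H.IsHermitian ∧ K.IsHermitian ∧ Y = H + Complex.I • K := by
  refine ⟨(2⁻¹ : ℂ) • (Y + Yᴴ), (-(Complex.I * 2⁻¹) : ℂ) • (Y - Yᴴ), ?_, ?_, ?_⟩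
  · rw [IsHermitian, conjTranspose_smul, conjTranspose_add, conjTranspose_conjTranspose, add_comm]
    simp
  · rw [IsHermitian, conjTranspose_smul, conjTranspose_sub, conjTranspose_conjTranspose,
      ← neg_sub Y, smul_neg, ← neg_smul]
    simp
  · ext i j
    simp only [Matrix.add_apply, Matrix.smul_apply, Matrix.sub_apply, smul_eq_mul]
    linear_combination ((2⁻¹ : ℂ) * (Y i j - Yᴴ i j)) * Complex.I_mul_I

variable [DecidableEq ι] {U : Matrix ι ι ℂ}

theorem reTr_mul_spec_le_abs {A : Matrix ι ι ℂ} (hA : A.IsHermitian) (h : ι → ℝ) :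
    reTr (A * spec U h * A) (spec U h)
      ≤ reTr (A * spec U (fun i => |h i|) * A) (spec U fun i => |h i|) := by
  set P := spec U fun i => max (h i) 0 with hP
  set N := spec U fun i => max (-h i) 0 with hN
  have h1 : spec U h = P - N := by
    rw [spec_sub]
    congr 1
    funext i
    rcases le_total 0 (h i) with hi | hi <;> simp [hi]
  have h2 : (spec U fun i => |h i|) = P + N := by
    rw [← sub_neg_eq_add, ← zero_sub, ← spec_zero (U := U), spec_sub, spec_sub]
    congr 1
    funext i
    rcases le_total 0 (h i) with hi | hi <;> simp [hi, abs_of_nonneg, abs_of_nonpos]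
  have hPp : P.PosSemidef := spec_posSemidef fun i => le_max_right _ _
  have hNp : N.PosSemidef := spec_posSemidef fun i => le_max_right _ _
  have conj : ∀ {Z : Matrix ι ι ℂ}, Z.PosSemidef → (A * Z * A).PosSemidef := fun hZ => by
    have := hZ.conjTranspose_mul_mul_same A
    rwa [hA.eq] at this
  have h3 := reTr_nonneg (conj hPp) hNp
  have h4 := reTr_nonneg (conj hNp) hPp
  rw [h1, h2]
  simp only [Matrix.mul_add, Matrix.mul_sub, Matrix.add_mul, Matrix.sub_mul, reTr_add_left,
    reTr_add_right, reTr_sub_left, reTr_sub_right]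
  linarith

theorem reTr_spec_mul_mul_spec (hU : U ∈ unitaryGroup ι ℂ) (g : ι → ℝ) (X Y : Matrix ι ι ℂ) :
    reTr (spec U g * X * spec U g) (spec U g * Y * spec U g)
      = reTr (X * spec U (fun i => g i * g i) * Y) (spec U fun i => g i * g i) := by
  rw [reTr, reTr, ← spec_mul_spec hU]
  simp only [Matrix.mul_assoc]
  rw [trace_mul_comm]
  simp only [Matrix.mul_assoc]

end Hermitian

theorem eq_zero_of_frobSq_eq_zero {ι : Type*} [Fintype ι] {X : Matrix ι ι ℂ}
    (h : frobSq X = 0) : X = 0 := by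
  ext i j
  have h1 := (Finset.sum_eq_zero_iff_of_nonneg
    (fun i _ => Finset.sum_nonneg fun j _ => sq_nonneg ‖X i j‖)).mp h i (Finset.mem_univ i)
  have h2 := (Finset.sum_eq_zero_iff_of_nonneg (fun j _ => sq_nonneg ‖X i j‖)).mp h1 j
    (Finset.mem_univ j)
  exact norm_eq_zero.mp (pow_eq_zero_iff two_ne_zero |>.mp h2)

namespace ProjGame

variable {G : ProjGame} {n d : ℕ}

/-- The operator `Σ_v μ(v|u) Σ_{b → a} F_v^b`. -/
def bop (G : ProjGame) {ι : Type*} (F : G.V → G.B → Matrix ι ι ℂ) (u : G.U) (a : G.A) :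
    Matrix ι ι ℂ :=
  ∑ v, (G.μc u v : ℂ) • G.crs F u v a

theorem Bop_eq_bop (B : G.V → G.B → Mat d) (u : G.U) (a : G.A) : G.Bop B u a = G.bop B u a :=
  Bop_eq_sum_crs B u a

/-- The value of a family of operators, measured with the unnormalized trace. -/
def trVal (G : ProjGame) {ι : Type*} [Fintype ι] (F : G.V → G.B → Matrix ι ι ℂ) : ℝ :=
  ∑ u, G.μL u * ∑ a, reTr (G.bop F u a) (G.bop F u a)

theorem trVal_eq {ι : Type*} [Fintype ι] (F : G.V → G.B → Matrix ι ι ℂ) :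
    G.trVal F = ∑ u, ∑ v, ∑ v', G.μ₃ u v v' * ∑ a, reTr (G.crs F u v a) (G.crs F u v' a) := by
  refine Finset.sum_congr rfl fun u _ => ?_
  simp only [bop, reTr_sum_left, reTr_sum_right, reTr_smul_left, reTr_smul_right, Finset.mul_sum,
    μ₃]
  rw [Finset.sum_comm]
  refine Finset.sum_congr rfl fun v _ => ?_
  rw [Finset.sum_comm]
  exact Finset.sum_congr rfl fun v' _ => Finset.sum_congr rfl fun a _ => by
    rw [reTr_comm]; ring

theorem crs_linear {ι κ : Type*} (φ : Matrix ι ι ℂ →ₗ[ℂ] Matrix κ κ ℂ)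
    (F : G.V → G.B → Matrix ι ι ℂ) (u : G.U) (v : G.V) (a : G.A) :
    G.crs (fun v b => φ (F v b)) u v a = φ (G.crs F u v a) := by
  simp only [crs, map_sum, apply_ite φ, map_zero]

theorem crs_blockDiagonal {ι o : Type*} [DecidableEq o] (F : G.V → G.B → o → Matrix ι ι ℂ)
    (u : G.U) (v : G.V) (a : G.A) :
    G.crs (fun v b => blockDiagonal (F v b)) u v a
      = blockDiagonal fun k => G.crs (fun v b => F v b k) u v a := by
  simp only [crs]
  rw [blockDiagonal_sum]
  refine Finset.sum_congr rfl fun b _ => ?_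
  split_ifs
  · rfl
  · exact blockDiagonal_zero.symm

theorem bop_linear {ι κ : Type*} (φ : Matrix ι ι ℂ →ₗ[ℂ] Matrix κ κ ℂ)
    (F : G.V → G.B → Matrix ι ι ℂ) (u : G.U) (a : G.A) :
    G.bop (fun v b => φ (F v b)) u a = φ (G.bop F u a) := by
  simp only [bop, crs_linear, map_sum, map_smul]

theorem bop_blockDiagonal {ι o : Type*} [DecidableEq o] (F : G.V → G.B → o → Matrix ι ι ℂ)
    (u : G.U) (a : G.A) :
    G.bop (fun v b => blockDiagonal (F v b)) u a
      = blockDiagonal fun k => G.bop (fun v b => F v b k) u a := by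
  simp only [bop, crs_blockDiagonal]
  rw [blockDiagonal_sum]
  exact Finset.sum_congr rfl fun v _ => (blockDiagonal_smul _ _).symm

/-- The quadratic form of `sqMat` at a Hermitian matrix. -/
def quad (G : ProjGame) (B : G.V → G.B → Mat d) (H : Mat d) : ℝ :=
  ∑ u, G.μL u * ∑ a, reTr (G.Bop B u a * H * G.Bop B u a) H

theorem re_braket_sqMat {B : G.V → G.B → Mat d} (hB : ∀ v b, (B v b).PosSemidef) {H K : Mat d}
    (hH : H.IsHermitian) (hK : K.IsHermitian) :
    (braket (fun p : Fin d × Fin d => (H + Complex.I • K) p.2 p.1) (G.sqMat B)).re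
      = G.quad B H + G.quad B K := by
  simp only [braket_sqMat hB, Complex.re_sum, Complex.re_ofReal_mul, re_trace_cartesian hH hK,
    quad, ← Finset.sum_add_distrib, ← mul_add]

theorem re_braket_vecMat {w : Fin n → ℝ} {A : Fin n → G.V → G.B → Mat d}
    (hA : ∀ i v b, (A i v b).PosSemidef) {H K : Mat d} (hH : H.IsHermitian)
    (hK : K.IsHermitian) :
    (braket (fun p : Fin d × Fin d => (H + Complex.I • K) p.2 p.1) (G.vecMat w A)).re
      = ∑ i, w i * G.quad (A i) H + ∑ i, w i * G.quad (A i) K := by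
  simp only [vecMat_eq, braket_sum, braket_smul, Complex.re_sum, Complex.re_ofReal_mul,
    re_braket_sqMat (hA _) hH hK, mul_add, Finset.sum_add_distrib]

theorem exists_hermitian_lt_quad {w : Fin n → ℝ} (hw : ∀ i, 0 ≤ w i)
    {A : Fin n → G.V → G.B → Mat d} (hA : ∀ i v b, (A i v b).PosSemidef) {c : ℝ} (hc : 0 ≤ c)
    (h : c < opNorm (G.vecMat w A)) :
    ∃ H : Mat d, H.IsHermitian ∧ c * frobSq H < ∑ i, w i * G.quad (A i) H := by
  obtain ⟨ψ, hψ⟩ := exists_lt_braket (vecMat_posSemidef hw hA) hc h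
  obtain ⟨H, K, hH, hK, hY⟩ := exists_cartesian (Matrix.of fun l k => ψ (k, l))
  have hψ' : ψ = fun p => (H + Complex.I • K) p.2 p.1 := by
    rw [← hY]
    rfl
  rw [hψ', re_braket_vecMat hA hH hK, enormSq_prod] at hψ
  change c * frobSq (H + Complex.I • K) < _ at hψ
  rw [frobSq_cartesian hH hK] at hψ
  by_contra! hcon
  linarith [hcon H hH, hcon K hK]

theorem quad_spec_le_abs {B : G.V → G.B → Mat d} (hB : ∀ v b, (B v b).PosSemidef) (U : Mat d)
    (h : Fin d → ℝ) : G.quad B (spec U h) ≤ G.quad B (spec U fun i => |h i|) :=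
  Finset.sum_le_sum fun u _ => mul_le_mul_of_nonneg_left
    (Finset.sum_le_sum fun a _ => reTr_mul_spec_le_abs (Bop_posSemidef hB u a).1 h) (μL_nonneg u)

theorem re_braket_vecMatAt {w : Fin n → ℝ} {A : Fin n → G.V → G.B → Mat d}
    (hA : ∀ i v b, (A i v b).PosSemidef) (v : G.V) {H : Mat d} (hH : H.IsHermitian) :
    (braket (fun p : Fin d × Fin d => H p.2 p.1) (G.vecMatAt w A v)).re
      = ∑ i, w i * reTr ((∑ b, A i v b) * H * ∑ b, A i v b) H := by
  simp only [vecMatAt, braket_sum, braket_smul, Complex.re_sum, Complex.re_ofReal_mul,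
    braket_kronecker (PosSemidef.sum_univ (hA _ v)).1, hH.eq]
  rfl

/-- The map `X ↦ c g X g`. -/
def sandwich (c : ℝ) (g : Mat d) : Mat d →ₗ[ℂ] Mat d where
  toFun X := (c : ℂ) • (g * X * g)
  map_add' X Y := by rw [Matrix.mul_add, Matrix.add_mul, smul_add]
  map_smul' r X := by
    rw [Matrix.mul_smul, Matrix.smul_mul, smul_comm, RingHom.id_apply]

theorem reTr_sandwich {U : Mat d} (hU : U ∈ unitaryGroup (Fin d) ℂ) (c : ℝ) (g : Fin d → ℝ)
    (X : Mat d) : reTr (sandwich c (spec U g) X) (sandwich c (spec U g) X)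
      = c ^ 2 * reTr (X * spec U (fun i => g i * g i) * X) (spec U fun i => g i * g i) := by
  change reTr ((c : ℂ) • _) ((c : ℂ) • _) = _
  rw [reTr_smul_left, reTr_smul_right, reTr_spec_mul_mul_spec hU]
  ring

/-- A vector strategy whose matrix has large norm yields a family of positive operators of large
value. -/
theorem exists_lt_trVal {w : Fin n → ℝ} (hw : ∀ i, 0 ≤ w i) {A : Fin n → G.V → G.B → Mat d}
    (hA : ∀ i v b, (A i v b).PosSemidef) (hA1 : ∀ v, opNorm (G.vecMatAt w A v) ≤ 1) {c : ℝ}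
    (hc : 0 ≤ c) (h : c < opNorm (G.vecMat w A)) :
    ∃ L : G.V → G.B → Matrix (Fin d × Fin n) (Fin d × Fin n) ℂ,
      (∀ v b, (L v b).PosSemidef) ∧ (∀ v, frobSq (∑ b, L v b) ≤ 1) ∧ c < G.trVal L := by
  obtain ⟨H, hH, hlt⟩ := exists_hermitian_lt_quad hw hA hc h
  obtain ⟨U, hU, hspec⟩ := hH.exists_eq_spec
  set h := hH.eigenvalues
  set g : Fin d → ℝ := fun i => √|h i| with hg
  have hgg : (fun i => g i * g i) = fun i => |h i| :=
    funext fun i => Real.mul_self_sqrt (abs_nonneg _)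
  have hf : frobSq (spec U fun i => |h i|) = frobSq H := by
    rw [hspec, frobSq_spec hU, frobSq_spec hU]
    simp only [sq_abs]
  have hpos : 0 < frobSq H := by
    refine (frobSq_nonneg H).lt_of_ne fun h0 => ?_
    rw [← h0, eq_zero_of_frobSq_eq_zero h0.symm] at hlt
    simp [quad, reTr] at hlt
  have hs : ∀ i, (√(w i) / √(frobSq H)) ^ 2 = w i / frobSq H := fun i => by
    rw [div_pow, Real.sq_sqrt (hw i), Real.sq_sqrt hpos.le]
  set φ : Fin n → Mat d →ₗ[ℂ] Mat d := fun i => sandwich (√(w i) / √(frobSq H)) (spec U g) with hφ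
  have hL : ∀ v b, (blockDiagonal fun i => φ i (A i v b)).PosSemidef := fun v b =>
    blockDiagonal_posSemidef fun i => (spec_mul_mul_spec_posSemidef (hA i v b) g).smul_real
      (by positivity)
  refine ⟨fun v b => blockDiagonal fun i => φ i (A i v b), hL, fun v => ?_, ?_⟩
  · rw [frobSq_eq_reTr (PosSemidef.sum_univ (hL v)).1, ← blockDiagonal_sum, reTr_blockDiagonal]
    simp only [← map_sum, hφ, reTr_sandwich hU, hs, hgg]
    have h1 := re_braket_le (fun p : Fin d × Fin d => spec U (fun i => |h i|) p.2 p.1)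
      (G.vecMatAt w A v)
    rw [re_braket_vecMatAt hA v (spec_isHermitian _), enormSq_prod] at h1
    change _ ≤ _ * frobSq (spec U fun i => |h i|) at h1
    rw [hf] at h1
    have h2 := mul_le_mul_of_nonneg_right (hA1 v) hpos.le
    simp only [div_mul_eq_mul_div, ← Finset.sum_div]
    rw [div_le_one hpos]
    linarith
  · have h1 : ∑ i, w i * G.quad (A i) H ≤ ∑ i, w i * G.quad (A i) (spec U fun i => |h i|) := by
      conv_lhs => rw [hspec]
      exact Finset.sum_le_sum fun i _ =>
        mul_le_mul_of_nonneg_left (quad_spec_le_abs (hA i) U h) (hw i)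
    have h2 : G.trVal (fun v b => blockDiagonal fun i => φ i (A i v b))
        = (∑ i, w i * G.quad (A i) (spec U fun i => |h i|)) / frobSq H := by
      simp only [trVal, bop_blockDiagonal, bop_linear, reTr_blockDiagonal, hφ, reTr_sandwich hU,
        hs, hgg, quad, Bop_eq_bop]
      simp only [Finset.mul_sum, Finset.sum_div]
      refine Eq.trans (Finset.sum_congr rfl fun u _ => ?_) Finset.sum_comm
      refine Eq.trans (Finset.sum_congr rfl fun a _ => ?_) Finset.sum_comm
      exact Finset.sum_congr rfl fun i _ => by ring
    rw [h2, lt_div_iff₀ hpos]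
    linarith

/-- The threshold compressions of all answers, collected into one block-diagonal operator. -/
def compressedFamily (G : ProjGame) {ι : Type*} [Fintype ι] [DecidableEq ι]
    (U : G.V → Matrix ι ι ℂ) (lam : G.V → ι → ℝ) (n : ℕ) (L : G.V → G.B → Matrix ι ι ℂ)
    (v : G.V) (b : G.B) : Matrix (ι × Fin n) (ι × Fin n) ℂ :=
  blockDiagonal fun k => compressed (U v) (lam v) n k (L v b)

section compressedFamily

variable {ι : Type*} [Fintype ι] [DecidableEq ι] {U : G.V → Matrix ι ι ℂ} {lam : G.V → ι → ℝ}
  {L : G.V → G.B → Matrix ι ι ℂ}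

theorem compressedFamily_posSemidef (hU : ∀ v, U v ∈ unitaryGroup ι ℂ) (n : ℕ)
    (hL : ∀ v b, (L v b).PosSemidef) (v : G.V) (b : G.B) :
    (G.compressedFamily U lam n L v b).PosSemidef :=
  blockDiagonal_posSemidef fun _ => compressed_posSemidef (hU v) _ _ _ (hL v b)

theorem sum_compressedFamily (hU : ∀ v, U v ∈ unitaryGroup ι ℂ) (h0 : ∀ v i, 0 ≤ lam v i)
    (hspec : ∀ v, ∑ b, L v b = spec (U v) (lam v)) (n : ℕ) (v : G.V) :
    ∑ b, G.compressedFamily U lam n L v b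
      = blockDiagonal fun k : Fin n => thrProj (U v) (lam v) n k := by
  simp only [compressedFamily, ← blockDiagonal_sum, ← compressed_sum, hspec,
    compressed_self (hU v) (h0 v)]

theorem one_sub_sum_compressedFamily_posSemidef (hU : ∀ v, U v ∈ unitaryGroup ι ℂ)
    (h0 : ∀ v i, 0 ≤ lam v i) (hspec : ∀ v, ∑ b, L v b = spec (U v) (lam v)) (n : ℕ) (v : G.V) :
    (1 - ∑ b, G.compressedFamily U lam n L v b).PosSemidef := by
  rw [sum_compressedFamily hU h0 hspec, ← blockDiagonal_one, ← blockDiagonal_sub]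
  refine blockDiagonal_posSemidef fun k => ?_
  change (1 - thrProj (U v) (lam v) n k).PosSemidef
  rw [← spec_one (hU v), thrProj, spec_sub]
  refine spec_posSemidef fun i => ?_
  nlinarith [thr_sq n k (lam v i), sq_nonneg (thr n k (lam v i) - 1)]

theorem trace_sum_compressedFamily_le (hU : ∀ v, U v ∈ unitaryGroup ι ℂ)
    (h0 : ∀ v i, 0 ≤ lam v i) (h1 : ∀ v, ∑ i, lam v i ^ 2 ≤ 1)
    (hspec : ∀ v, ∑ b, L v b = spec (U v) (lam v)) (n : ℕ) (v : G.V) :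
    (trace (∑ b, G.compressedFamily U lam n L v b)).re ≤ n := by
  rw [sum_compressedFamily hU h0 hspec, trace_blockDiagonal, Complex.re_sum]
  simp only [thrProj, trace_spec_re (hU v)]
  rw [Finset.sum_comm]
  refine (Finset.sum_le_sum fun i _ => sum_thr_le (sq_le_one_of_sum (h1 v) i)).trans ?_
  rw [← Finset.mul_sum]
  exact mul_le_of_le_one_right n.cast_nonneg (h1 v)

theorem crs_compressedFamily (n : ℕ) (u : G.U) (v : G.V) (a : G.A) :
    G.crs (G.compressedFamily U lam n L) u v a
      = blockDiagonal fun k : Fin n => compressed (U v) (lam v) n k (G.crs L u v a) := by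
  have h := crs_blockDiagonal (G := G)
    (fun v b (k : Fin n) => compressed (U v) (lam v) n k (L v b)) u v a
  refine h.trans (congrArg _ (funext fun k => ?_))
  simp only [crs, compressed_sum]
  refine Finset.sum_congr rfl fun b _ => ?_
  split_ifs
  · rfl
  · simp [compressed, normalized]

theorem le_sum_reTr_crs_compressedFamily (hU : ∀ v, U v ∈ unitaryGroup ι ℂ)
    (h0 : ∀ v i, 0 ≤ lam v i) (h1 : ∀ v, ∑ i, lam v i ^ 2 ≤ 1)
    (hL : ∀ v b, (L v b).PosSemidef) (hspec : ∀ v, ∑ b, L v b = spec (U v) (lam v))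
    {θ : ℝ} (hθ : 0 < θ) (hθ1 : θ ≤ 1) {n : ℕ} (hn : Fintype.card ι ≤ n * θ) (u : G.U)
    (v v' : G.V) :
    n * (1 - 56 * (1 - ∑ a, reTr (G.crs L u v a) (G.crs L u v' a)) / θ - 22 * θ)
      ≤ ∑ a, reTr (G.crs (G.compressedFamily U lam n L) u v a)
          (G.crs (G.compressedFamily U lam n L) u v' a) := by
  have hc := fun v a => crs_posSemidef hL u v a
  have hs := fun v => sum_sub_sum_crs_posSemidef hL u v
  simp only [hspec] at hs
  have h := le_sum_reTr_compressed (hU v) (hU v') (h0 v) (h0 v') (h1 v) (h1 v') (hc v) (hs v)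
    (hc v') (hs v') hθ hθ1 hn
  have hD : (1 - ∑ a, frobSq (G.crs L u v a)) + (1 - ∑ a, frobSq (G.crs L u v' a))
      + ∑ a, frobSq (G.crs L u v a - G.crs L u v' a)
      = 2 * (1 - ∑ a, reTr (G.crs L u v a) (G.crs L u v' a)) := by
    rw [Finset.sum_congr rfl fun a _ => frobSq_sub (hc v a).1 (hc v' a).1,
      Finset.sum_sub_distrib, Finset.sum_add_distrib, ← Finset.mul_sum]
    ring
  rw [hD, ← mul_assoc] at h
  norm_num at h
  simpa only [crs_compressedFamily, reTr_blockDiagonal] using h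

end compressedFamily

theorem sum_μ₃_mul_const (c : ℝ) : ∑ u, ∑ v, ∑ v', G.μ₃ u v v' * c = c := by
  simp only [← Finset.sum_mul, sum_μ₃, one_mul]

/-- Rounding a family of operators of large value to a measurement of large value. -/
theorem exists_povm_le_trVal {ι : Type} [Fintype ι] [DecidableEq ι] [Nonempty ι]
    {L : G.V → G.B → Matrix ι ι ℂ} (hL : ∀ v b, (L v b).PosSemidef)
    (hL1 : ∀ v, frobSq (∑ b, L v b) ≤ 1) (b₀ : G.B) {θ : ℝ} (hθ : 0 < θ) (hθ1 : θ ≤ 1)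
    {η : ℝ} (hη : 0 < η) :
    ∃ (I : Type) (_ : Fintype I) (_ : DecidableEq I) (_ : Nonempty I)
      (B : G.V → G.B → Matrix I I ℂ),
      (∀ v b, (B v b).PosSemidef) ∧ (∀ v, ∑ b, B v b = 1) ∧
        1 - 112 * (1 - G.trVal L) / θ - 44 * θ - η ≤ G.trVal B / Fintype.card I := by
  have hS : ∀ v, (∑ b, L v b).PosSemidef := fun v => PosSemidef.sum_univ (hL v)
  have hdiag : ∀ v, ∃ (U : Matrix ι ι ℂ) (lam : ι → ℝ), U ∈ unitaryGroup ι ℂ ∧ (∀ i, 0 ≤ lam i) ∧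
      ∑ b, L v b = spec U lam := fun v => by
    obtain ⟨U, hU, h⟩ := (hS v).1.exists_eq_spec
    exact ⟨U, _, hU, (hS v).eigenvalues_nonneg, h⟩
  choose U lam hU h0 hspec using hdiag
  have h1 : ∀ v, ∑ i, lam v i ^ 2 ≤ 1 := fun v => by
    rw [← frobSq_spec (hU v), ← hspec]
    exact hL1 v
  have hcard : (0 : ℝ) < Fintype.card ι := by exact_mod_cast Fintype.card_pos
  obtain ⟨n, hn⟩ := exists_nat_ge (Fintype.card ι / θ)
  rw [div_le_iff₀ hθ] at hn
  have hn0 : (0 : ℝ) < n := pos_of_mul_pos_left (hcard.trans_le hn) hθ.le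
  have : Nonempty (Fin n) := ⟨⟨0, by exact_mod_cast hn0⟩⟩
  set ρ : ℝ := (Fintype.card ι : ℝ)⁻¹ with hρ
  have hρ0 : 0 < ρ := inv_pos.mpr hcard
  have hρ1 : ρ ≤ 1 := inv_le_one_of_one_le₀ (by exact_mod_cast Fintype.card_pos (α := ι))
  have hρJ : ρ * Fintype.card (ι × Fin n) = n := by
    rw [Fintype.card_prod, Fintype.card_fin, Nat.cast_mul, hρ, inv_mul_cancel_left₀ hcard.ne']
  obtain ⟨t, ht⟩ := exists_pow_lt_of_lt_one hη (sub_lt_self 1 hρ0)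
  obtain ⟨I, _, _, _, B, hB, hB1, hval⟩ := exists_povm_of_subPOVM
    (compressedFamily_posSemidef (lam := lam) hU n hL)
    (one_sub_sum_compressedFamily_posSemidef hU h0 hspec n) hρ0 hρ1
    (fun v => (trace_sum_compressedFamily_le hU h0 h1 hspec n v).trans hρJ.ge) b₀ t
  refine ⟨I, inferInstance, inferInstance, inferInstance, B, hB, hB1, ?_⟩
  have hpt : ∀ u v v', 1 - 112 / θ - 44 * θ - η
      + 112 / θ * ∑ a, reTr (G.crs L u v a) (G.crs L u v' a)
        ≤ (∑ a, reTr (G.crs B u v a) (G.crs B u v' a)) / Fintype.card I := fun u v v' => by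
    refine le_trans ?_ (hval u v v')
    have h2 := le_sum_reTr_crs_compressedFamily hU h0 h1 hL hspec hθ hθ1 hn u v v'
    rw [mul_comm, ← le_div_iff₀ hn0] at h2
    rw [hρJ]
    have h3 : 56 * (1 - ∑ a, reTr (G.crs L u v a) (G.crs L u v' a)) / θ
        = (112 / θ - 112 / θ * ∑ a, reTr (G.crs L u v a) (G.crs L u v' a)) / 2 := by
      field_simp
      ring
    linarith
  calc 1 - 112 * (1 - G.trVal L) / θ - 44 * θ - η
      = (1 - 112 / θ - 44 * θ - η) + 112 / θ * G.trVal L := by ring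
    _ = ∑ u, ∑ v, ∑ v', G.μ₃ u v v' * ((1 - 112 / θ - 44 * θ - η)
          + 112 / θ * ∑ a, reTr (G.crs L u v a) (G.crs L u v' a)) := by
        simp only [mul_add, Finset.sum_add_distrib, sum_μ₃_mul_const, trVal_eq, Finset.mul_sum]
        congr 1
        refine Finset.sum_congr rfl fun u _ => Finset.sum_congr rfl fun v _ =>
          Finset.sum_congr rfl fun v' _ => Finset.sum_congr rfl fun a _ => by ring
    _ ≤ ∑ u, ∑ v, ∑ v', G.μ₃ u v v'
          * ((∑ a, reTr (G.crs B u v a) (G.crs B u v' a)) / Fintype.card I) :=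
        Finset.sum_le_sum fun u _ => Finset.sum_le_sum fun v _ => Finset.sum_le_sum fun v' _ =>
          mul_le_mul_of_nonneg_left (hpt u v v') (μ₃_nonneg u v v')
    _ = G.trVal B / Fintype.card I := by
        simp only [trVal_eq, Finset.sum_div, mul_div_assoc]

theorem trVal_le_one {ι : Type*} [Fintype ι] [DecidableEq ι] {L : G.V → G.B → Matrix ι ι ℂ}
    (hL : ∀ v b, (L v b).PosSemidef) (hL1 : ∀ v, frobSq (∑ b, L v b) ≤ 1) : G.trVal L ≤ 1 := by
  have hS : ∀ v, (∑ b, L v b).PosSemidef := fun v => PosSemidef.sum_univ (hL v)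
  rw [trVal_eq, ← sum_μ₃_mul_const (G := G) 1]
  refine Finset.sum_le_sum fun u _ => Finset.sum_le_sum fun v _ => Finset.sum_le_sum fun v' _ =>
    mul_le_mul_of_nonneg_left ((sum_reTr_crs_le hL u v v').trans ?_) (μ₃_nonneg u v v')
  have h := frobSq_sub (hS v).1 (hS v').1
  linarith [frobSq_nonneg (∑ b, L v b - ∑ b, L v' b), hL1 v, hL1 v']

theorem opNorm_vecMat_le_one {w : Fin n → ℝ} (hw : ∀ i, 0 ≤ w i)
    {A : Fin n → G.V → G.B → Mat d} (hA : ∀ i v b, (A i v b).PosSemidef)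
    (hA1 : ∀ v, opNorm (G.vecMatAt w A v) ≤ 1) : opNorm (G.vecMat w A) ≤ 1 := by
  by_contra! h
  obtain ⟨L, hL, hL1, hlt⟩ := exists_lt_trVal hw hA hA1 zero_le_one h
  exact hlt.not_ge (trVal_le_one hL hL1)

/-- The set of values of vector strategies, of which `valPlus` is the supremum. -/
def valPlusSet (G : ProjGame) : Set ℝ :=
  { x | ∃ (n d : ℕ) (w : Fin n → ℝ) (A : Fin n → G.V → G.B → Mat d),
    (∀ i, 0 < w i) ∧ G.IsVecStrategy A ∧
    (∀ v, Real.sqrt (opNorm (G.vecMatAt w A v)) ≤ 1) ∧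
    x = opNorm (G.vecMat w A) }

theorem le_one_of_mem_valPlusSet {x : ℝ} (hx : x ∈ G.valPlusSet) : x ≤ 1 := by
  obtain ⟨n, d, w, A, hw, hA, hA1, rfl⟩ := hx
  exact opNorm_vecMat_le_one (fun i => (hw i).le) (fun i v => (hA i v).1)
    fun v => Real.sqrt_le_one.mp (hA1 v)

theorem opNorm_sqMat_mem_valPlusSet {B : G.V → G.B → Mat d} (hB : G.IsStrategyB B) :
    opNorm (G.sqMat B) ∈ G.valPlusSet := by
  refine ⟨1, d, fun _ => 1, fun _ => B, fun _ => one_pos, fun _ v => ⟨(hB v).1, ?_⟩, fun v => ?_,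
    ?_⟩
  · rw [(hB v).2, sub_self]
    exact PosSemidef.zero
  · have h : G.vecMatAt (fun _ : Fin 1 => 1) (fun _ => B) v = 1 := by
      simp [vecMatAt, (hB v).2, mconj]
    rw [h]
    exact Real.sqrt_le_one.mpr opNorm_one_le
  · rw [vecMat_eq]
    simp

theorem bddAbove_valPlusSet : BddAbove G.valPlusSet := ⟨1, fun _ => le_one_of_mem_valPlusSet⟩

theorem exists_isStrategyB (G : ProjGame) : ∃ B : G.V → G.B → Mat 0, G.IsStrategyB B :=
  ⟨fun _ _ => 0, fun _ => ⟨fun _ => PosSemidef.zero, Subsingleton.elim _ _⟩⟩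

theorem valPlus_le_one : G.valPlus ≤ 1 := by
  obtain ⟨B, hB⟩ := G.exists_isStrategyB
  exact csSup_le ⟨_, opNorm_sqMat_mem_valPlusSet hB⟩ fun _ => le_one_of_mem_valPlusSet

theorem opNorm_sqMat_le_valPlus {B : G.V → G.B → Mat d} (hB : G.IsStrategyB B) :
    opNorm (G.sqMat B) ≤ G.valPlus :=
  le_csSup bddAbove_valPlusSet (opNorm_sqMat_mem_valPlusSet hB)

theorem valPlus_nonneg : 0 ≤ G.valPlus := by
  obtain ⟨B, hB⟩ := G.exists_isStrategyB
  exact (opNorm_nonneg _).trans (opNorm_sqMat_le_valPlus hB)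

theorem sqrt_opNorm_sqMat_le_sqNorm {B : G.V → G.B → Mat d} (hB : G.IsStrategyB B) :
    √(opNorm (G.sqMat B)) ≤ G.sqNorm := by
  refine le_csSup ⟨√G.valPlus, ?_⟩ ⟨d, B, hB, rfl⟩
  rintro _ ⟨d, B, hB, rfl⟩
  exact Real.sqrt_le_sqrt (opNorm_sqMat_le_valPlus hB)

theorem sqNorm_nonneg : 0 ≤ G.sqNorm := by
  obtain ⟨B, hB⟩ := G.exists_isStrategyB
  exact (Real.sqrt_nonneg _).trans (sqrt_opNorm_sqMat_le_sqNorm hB)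

theorem sqNorm_sq_le_valPlus : G.sqNorm ^ 2 ≤ G.valPlus := by
  rw [← Real.le_sqrt sqNorm_nonneg valPlus_nonneg]
  obtain ⟨B, hB⟩ := G.exists_isStrategyB
  refine csSup_le ⟨_, 0, B, hB, rfl⟩ ?_
  rintro _ ⟨d, B, hB, rfl⟩
  exact Real.sqrt_le_sqrt (opNorm_sqMat_le_valPlus hB)

theorem trVal_le_mul_sqNorm_sq {B : G.V → G.B → Mat d} (hB : G.IsStrategyB B) :
    G.trVal B ≤ d * G.sqNorm ^ 2 := by
  have h1 : (braket (fun p : Fin d × Fin d => (1 : Mat d) p.2 p.1) (G.sqMat B)).re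
      = G.trVal B := by
    rw [braket_sqMat fun v => (hB v).1]
    simp only [Complex.re_sum, Complex.re_ofReal_mul, Matrix.mul_one, conjTranspose_one, Bop_eq_bop]
    rfl
  have h2 : enormSq (fun p : Fin d × Fin d => (1 : Mat d) p.2 p.1) = d := by
    rw [enormSq_prod]
    change frobSq (1 : Mat d) = d
    rw [frobSq_one, Fintype.card_fin]
  have h3 := re_braket_le (fun p : Fin d × Fin d => (1 : Mat d) p.2 p.1) (G.sqMat B)
  rw [h1, h2] at h3
  have h4 := (Real.sqrt_le_left sqNorm_nonneg).mp (sqrt_opNorm_sqMat_le_sqNorm hB)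
  calc G.trVal B ≤ opNorm (G.sqMat B) * d := h3
    _ ≤ G.sqNorm ^ 2 * d := mul_le_mul_of_nonneg_right h4 d.cast_nonneg
    _ = d * G.sqNorm ^ 2 := mul_comm _ _

theorem trVal_submatrix {ι κ : Type*} [Fintype ι] [Fintype κ] (e : κ ≃ ι)
    (B : G.V → G.B → Matrix ι ι ℂ) :
    G.trVal (fun v b => (B v b).submatrix e e) = G.trVal B := by
  have h : ∀ u a, G.bop (fun v b => (B v b).submatrix e e) u a = (G.bop B u a).submatrix e e :=
    fun u a => bop_linear (reindexLinearEquiv ℂ ℂ e.symm e.symm).toLinearMap B u a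
  simp only [trVal, h, reTr, submatrix_mul_equiv]
  refine Finset.sum_congr rfl fun u _ => congrArg _ (Finset.sum_congr rfl fun a _ => ?_)
  exact congrArg _ (Equiv.sum_comp e fun i => (G.bop B u a * G.bop B u a) i i)

theorem trVal_div_card_le_sqNorm_sq {I : Type*} [Fintype I] [DecidableEq I] [Nonempty I]
    {B : G.V → G.B → Matrix I I ℂ} (hB : ∀ v b, (B v b).PosSemidef) (hB1 : ∀ v, ∑ b, B v b = 1) :
    G.trVal B / Fintype.card I ≤ G.sqNorm ^ 2 := by
  have e := (Fintype.equivFin I).symm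
  have hs : G.IsStrategyB fun v b => (B v b).submatrix e e := fun v =>
    ⟨fun b => (hB v b).submatrix e, by
      have h := map_sum (reindexLinearEquiv ℂ ℂ e.symm e.symm) (fun b => B v b) Finset.univ
      refine h.symm.trans ?_
      rw [hB1]
      exact submatrix_one_equiv e⟩
  rw [div_le_iff₀ (by exact_mod_cast Fintype.card_pos), mul_comm, ← trVal_submatrix e]
  exact trVal_le_mul_sqNorm_sq hs

/-- A family of positive operators of value close to `1` forces the square norm to be close
to `1`. -/
theorem one_sub_le_sqNorm_sq {ι : Type} [Fintype ι] [DecidableEq ι]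
    {L : G.V → G.B → Matrix ι ι ℂ} (hL : ∀ v b, (L v b).PosSemidef)
    (hL1 : ∀ v, frobSq (∑ b, L v b) ≤ 1) {θ : ℝ} (hθ : 0 < θ) (hθ1 : θ < 1)
    (h : 1 - θ ^ 2 < G.trVal L) : 1 - 156 * θ ≤ G.sqNorm ^ 2 := by
  have hpos : 0 < G.trVal L := by nlinarith
  have hι : Nonempty ι := by
    by_contra hι
    rw [not_nonempty_iff] at hι
    simp [trVal, reTr, trace] at hpos
  obtain ⟨b₀⟩ : Nonempty G.B := by
    by_contra hb
    rw [not_nonempty_iff] at hb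
    simp [trVal, reTr, bop, crs] at hpos
  refine le_of_forall_pos_le_add fun η hη => ?_
  obtain ⟨I, _, _, _, B, hB, hB1, hval⟩ := exists_povm_le_trVal hL hL1 b₀ hθ hθ1.le hη
  have h1 := hval.trans (trVal_div_card_le_sqNorm_sq hB hB1)
  have h2 : 112 * (1 - G.trVal L) / θ ≤ 112 * θ := by
    rw [div_le_iff₀ hθ]
    nlinarith
  linarith

theorem valPlus_le : G.valPlus ≤ 1 - 1 / 40000 * (1 - G.sqNorm ^ 2) ^ 2 := by
  set x := 1 - G.sqNorm ^ 2 with hx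
  have hx0 : 0 ≤ x := by linarith [sqNorm_sq_le_valPlus (G := G), valPlus_le_one (G := G)]
  have hx1 : x ≤ 1 := by linarith [sq_nonneg G.sqNorm]
  rcases hx0.eq_or_lt with h0 | h0
  · rw [← h0]
    linarith [valPlus_le_one (G := G)]
  by_contra! hlt
  obtain ⟨B, hB⟩ := G.exists_isStrategyB
  obtain ⟨_, ⟨n, d, w, A, hw, hA, hA1, rfl⟩, hy⟩ :=
    exists_lt_of_lt_csSup ⟨_, opNorm_sqMat_mem_valPlusSet hB⟩ hlt
  obtain ⟨L, hL, hL1, hlt⟩ := exists_lt_trVal (fun i => (hw i).le) (fun i v => (hA i v).1)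
    (fun v => Real.sqrt_le_one.mp (hA1 v)) (by nlinarith) hy
  have h := one_sub_le_sqNorm_sq hL hL1 (θ := x / 200) (by positivity) (by linarith) (by nlinarith)
  linarith

end ProjGame

/-- There exist universal constants `C > 0`, `c ≥ 1` such that for any projection game `G`,
`‖G‖*² ≤ val₊*(G) ≤ 1 − C(1 − ‖G‖*²)^c`. -/
theorem sqNorm_sq_le_valPlus_le :
    ∃ C c : ℝ, 0 < C ∧ 1 ≤ c ∧ ∀ G : ProjGame,
      G.sqNorm ^ 2 ≤ G.valPlus ∧
      G.valPlus ≤ 1 - C * (1 - G.sqNorm ^ 2) ^ c := by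
  refine ⟨1 / 40000, 2, by norm_num, by norm_num, fun G => ⟨ProjGame.sqNorm_sq_le_valPlus, ?_⟩⟩
  rw [Real.rpow_two]
  exact ProjGame.valPlus_le
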